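/- arXiv:2112.13695 — 9 statements merged into one kernel-verified Lean document; each statement's English description precedes it below -/
import Mathlib

section
/- Let a ≥ 0, let C be a real constant, let K : (0,∞) → ℝ be a locally integrable function with K(t) ≥ 0 for all t > 0 and ∫₀ˣ K(t) dt > 0 for all x ≥ a, and let f : [0,∞) → ℝ be continuous with K·f locally integrable, satisfying f(x+1) = (∫₀ˣ K(t) f(t) dt + C) / (∫₀ˣ K(t) dt) for every x ≥ a. Then for every x ≥ a + 2 one has inf_{x−1 ≤ t ≤ x} f(t) ≤ inf_{x ≤ t ≤ x+1} f(t) ≤ sup_{x ≤ t ≤ x+1} f(t) ≤ sup_{x−1 ≤ t ≤ x} f(t). -/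
open MeasureTheory

/-- If a solution of the renewal equation is bounded above by `M` on `[x - 1, x]`, then it is
bounded above by `M` on `[x, x + 1]`. -/
theorem renewal_le_of_le_on_unit_interval
    {a C : ℝ} (ha : 0 ≤ a) {K f : ℝ → ℝ}
    (hK0 : ∀ t : ℝ, 0 < t → 0 ≤ K t)
    (hKpos : ∀ x : ℝ, a ≤ x → 0 < ∫ t in (0:ℝ)..x, K t)
    (hf : ContinuousOn f (Set.Ici 0))
    (heq : ∀ x : ℝ, a ≤ x →
      f (x + 1) = ((∫ t in (0:ℝ)..x, K t * f t) + C) / (∫ t in (0:ℝ)..x, K t))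
    {x M : ℝ} (hx : a + 1 ≤ x) (hM : ∀ t ∈ Set.Icc (x - 1) x, f t ≤ M)
    {t : ℝ} (ht : t ∈ Set.Icc x (x + 1)) : f t ≤ M := by
  obtain ⟨z, rfl⟩ : ∃ z, t = z + 1 := ⟨t - 1, by ring⟩
  have hyz : x - 1 ≤ z := by linarith [ht.1]
  have hzx : z ≤ x := by linarith [ht.2]
  have hy : a ≤ x - 1 := by linarith
  have hz : a ≤ z := hy.trans hyz
  have hK : ∀ u, a ≤ u → IntervalIntegrable K volume 0 u := fun u hu =>
    intervalIntegral.intervalIntegrable_of_integral_ne_zero (hKpos u hu).ne'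
  have hKf : ∀ u, a ≤ u → IntervalIntegrable (fun t => K t * f t) volume 0 u := fun u hu =>
    (hK u hu).mul_continuousOn <| hf.mono <| by
      rw [Set.uIcc_of_le (ha.trans hu)]
      exact Set.Icc_subset_Ici_self
  have hKyz := (hK _ hy).symm.trans (hK _ hz)
  have hKfyz := (hKf _ hy).symm.trans (hKf _ hz)
  have split := intervalIntegral.integral_add_adjacent_intervals (hK _ hy) hKyz
  have split' := intervalIntegral.integral_add_adjacent_intervals (hKf _ hy) hKfyz
  have hle : ∫ t in (x - 1)..z, K t * f t ≤ ∫ t in (x - 1)..z, K t * M := by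
    refine intervalIntegral.integral_mono_on_of_le_Ioo hyz hKfyz (hKyz.mul_const M) fun s hs => ?_
    exact mul_le_mul_of_nonneg_left (hM s ⟨hs.1.le, hs.2.le.trans hzx⟩)
      (hK0 s (by linarith [hs.1]))
  rw [intervalIntegral.integral_mul_const] at hle
  have hfx := hM x ⟨by linarith, le_rfl⟩
  have hx_eq := heq _ hy
  rw [sub_add_cancel] at hx_eq
  rw [hx_eq, div_le_iff₀ (hKpos _ hy)] at hfx
  rw [heq z hz, div_le_iff₀ (hKpos z hz), ← split, ← split']
  linarith

/-- **Theorem 1 of the paper.** For a nonnegative kernel `K` and a continuous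
function `f` satisfying the renewal-type integral equation
`f (x+1) = ((∫₀ˣ K t * f t dt) + C) / (∫₀ˣ K t dt)` for all `x ≥ a`,
the one-step infima increase and the one-step suprema decrease for `x ≥ a + 2`. -/
theorem renewal_inf_sup_monotone
    (a C : ℝ) (ha : 0 ≤ a) (K f : ℝ → ℝ)
    (hK0 : ∀ t : ℝ, 0 < t → 0 ≤ K t)
    (hKloc : LocallyIntegrableOn K (Set.Ioi 0))
    (hKpos : ∀ x : ℝ, a ≤ x → 0 < ∫ t in (0:ℝ)..x, K t)
    (hf : ContinuousOn f (Set.Ici 0))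
    (hKfloc : LocallyIntegrableOn (fun t => K t * f t) (Set.Ioi 0))
    (heq : ∀ x : ℝ, a ≤ x →
      f (x + 1) = ((∫ t in (0:ℝ)..x, K t * f t) + C) / (∫ t in (0:ℝ)..x, K t)) :
    ∀ x : ℝ, a + 2 ≤ x →
      sInf (f '' Set.Icc (x - 1) x) ≤ sInf (f '' Set.Icc x (x + 1)) ∧
      sInf (f '' Set.Icc x (x + 1)) ≤ sSup (f '' Set.Icc x (x + 1)) ∧
      sSup (f '' Set.Icc x (x + 1)) ≤ sSup (f '' Set.Icc (x - 1) x) := by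
  intro x hx
  have hsub : ∀ u v : ℝ, 0 ≤ u → ContinuousOn f (Set.Icc u v) := fun u v hu =>
    hf.mono fun t ht => hu.trans ht.1
  have hcomp := isCompact_Icc.image_of_continuousOn (hsub (x - 1) x (by linarith))
  have hcomp' := isCompact_Icc.image_of_continuousOn (hsub x (x + 1) (by linarith))
  have hne : (f '' Set.Icc x (x + 1)).Nonempty := (Set.nonempty_Icc.2 (by linarith)).image f
  refine ⟨le_csInf hne ?_, csInf_le_csSup hne hcomp'.bddBelow hcomp'.bddAbove, csSup_le hne ?_⟩
  · rintro _ ⟨t, ht, rfl⟩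
    refine neg_le_neg_iff.1 <| renewal_le_of_le_on_unit_interval (C := -C) (f := fun t => -f t)
      ha hK0 hKpos hf.neg (fun y hy => ?_) (by linarith) (fun s hs => ?_) ht
    · simp only [heq y hy, mul_neg, intervalIntegral.integral_neg]
      ring
    · exact neg_le_neg (csInf_le hcomp.bddBelow ⟨s, hs, rfl⟩)
  · rintro _ ⟨t, ht, rfl⟩
    exact renewal_le_of_le_on_unit_interval ha hK0 hKpos hf heq (by linarith)
      (fun s hs => le_csSup hcomp.bddAbove ⟨s, hs, rfl⟩) ht
end

section
/- For each λ > 0 let N_λ : ℝ → ℝ satisfy the exponential derivative equation with rate λ, with N_λ ≥ 0 and N_λ continuous on (2,∞), and let N : ℝ → ℝ satisfy the uniform derivative equation, with N continuous on (2,∞). Then for every real n ≥ 2, sup_{2 < x ≤ n} |N_λ(x) − N(x)| → 0 as λ → 0⁺; that is, N_λ converges to N uniformly on compact subsets of [0,∞) away from the points 1 and 2 (on (0,1) ∪ (1,2) both functions vanish). -/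
open MeasureTheory Filter

/-- `N` satisfies the exponential derivative equation with rate `lam`:
`N = 0` on `(0,1) ∪ (1,2)` and for every `x > 1`,
`N (x+1) = ((∫₁ˣ lam * sinh (lam*t) * N t dt) + lam * sinh lam) / (cosh (lam*x) - 1)`. -/
def SatisfiesExpDerivEq (lam : ℝ) (N : ℝ → ℝ) : Prop :=
  (∀ x : ℝ, (0 < x ∧ x < 1) ∨ (1 < x ∧ x < 2) → N x = 0) ∧
  ∀ x : ℝ, 1 < x →
    N (x + 1) = ((∫ t in (1:ℝ)..x, lam * Real.sinh (lam * t) * N t)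
      + lam * Real.sinh lam) / (Real.cosh (lam * x) - 1)

/-- `N` satisfies the uniform derivative equation:
`N = 0` on `(0,1) ∪ (1,2)` and for every `x > 1`,
`N (x+1) = ((∫₁ˣ 2*t*N t dt) + 2) / x²`. -/
def SatisfiesUnifDerivEq (N : ℝ → ℝ) : Prop :=
  (∀ x : ℝ, (0 < x ∧ x < 1) ∨ (1 < x ∧ x < 2) → N x = 0) ∧
  ∀ x : ℝ, 1 < x →
    N (x + 1) = ((∫ t in (1:ℝ)..x, 2 * t * N t) + 2) / x ^ 2

open Set Topology

/-- On a bounded interval the ratio `sinh (lam * u) / (lam * u)` is eventually at most `1 + δ`. -/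
lemma eventually_sinh_mul_le {K δ : ℝ} (hK : 0 < K) (hδ : 0 < δ) :
    ∀ᶠ lam : ℝ in 𝓝[>] 0, ∀ u ∈ Ioc 0 K,
      Real.sinh (lam * u) ≤ (1 + δ) * (lam * u) := by
  have hd : HasDerivAt Real.sinh 1 0 := by simpa using Real.hasDerivAt_sinh 0
  have hb := (hasDerivAt_iff_isLittleO_nhds_zero.1 hd).def hδ
  obtain ⟨r, hr, hball⟩ := Metric.eventually_nhds_iff.1 hb
  have hsmall : ∀ᶠ lam : ℝ in 𝓝[>] 0, lam < r / K :=
    nhdsWithin_le_nhds (gt_mem_nhds (div_pos hr hK))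
  filter_upwards [hsmall, self_mem_nhdsWithin] with lam hlam hpos u hu
  have hlam0 : 0 < lam := hpos
  have hu0 : 0 < lam * u := mul_pos hlam0 hu.1
  have hur : lam * u < r :=
    (mul_le_mul_of_nonneg_left hu.2 hlam0.le).trans_lt ((lt_div_iff₀ hK).1 hlam)
  have h := hball (y := lam * u) (by rwa [Real.dist_eq, sub_zero, abs_of_pos hu0])
  simp only [zero_add, Real.sinh_zero, sub_zero, smul_eq_mul, mul_one, Real.norm_eq_abs,
    abs_of_pos hu0] at h
  linarith [(abs_le.1 h).2]

lemma norm_le_of_bound_off_two {f : ℝ → ℝ} {K M : ℝ} (hM : 0 ≤ M)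
    (hzero : ∀ t ∈ Ioo (1 : ℝ) 2, f t = 0) (hbound : ∀ t ∈ Ioc 2 K, |f t| ≤ M) :
    ∀ t ∈ Ioc 1 K, t ≠ 2 → |f t| ≤ M := by
  intro t ht ht2
  rcases lt_or_gt_of_ne ht2 with h | h
  · simpa [hzero t ⟨ht.1, h⟩] using hM
  · exact hbound t ⟨h, ht.2⟩

/-- A bounded function that vanishes on `(1, 2)` and is continuous on `(2, ∞)` is interval
integrable from `1`. -/
lemma intervalIntegrable_of_vanishing_of_bound {f : ℝ → ℝ} {y M : ℝ} (hy : 1 ≤ y) (hM : 0 ≤ M)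
    (hzero : ∀ t ∈ Ioo (1 : ℝ) 2, f t = 0) (hcont : ContinuousOn f (Ioi 2))
    (hbound : ∀ t ∈ Ioc 2 y, |f t| ≤ M) :
    IntervalIntegrable f volume 1 y := by
  rw [intervalIntegrable_iff_integrableOn_Ioc_of_le hy]
  have hmeas : AEStronglyMeasurable f (volume.restrict (Ioc 1 y)) := by
    have h1 : AEStronglyMeasurable f (volume.restrict (Ioo 1 2)) :=
      (continuousOn_const.congr hzero).aestronglyMeasurable measurableSet_Ioo
    have h2 : AEStronglyMeasurable f (volume.restrict (Ioi 2)) :=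
      hcont.aestronglyMeasurable measurableSet_Ioi
    have h3 : AEStronglyMeasurable f (volume.restrict {2}) := by
      rw [Measure.restrict_singleton]; simp
    refine AEStronglyMeasurable.mono_set ?_ (aestronglyMeasurable_union_iff.2
      ⟨aestronglyMeasurable_union_iff.2 ⟨h1, h2⟩, h3⟩)
    intro t ht
    rcases lt_trichotomy t 2 with h | h | h
    · exact Or.inl (Or.inl ⟨ht.1, h⟩)
    · exact Or.inr h
    · exact Or.inl (Or.inr h)
  refine IntegrableOn.of_bound measure_Ioc_lt_top hmeas M ?_
  have hne : ∀ᵐ t ∂(volume.restrict (Ioc 1 y)), t ≠ (2 : ℝ) := Measure.ae_ne _ 2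
  filter_upwards [hne, ae_restrict_mem measurableSet_Ioc] with t ht2 ht
  exact norm_le_of_bound_off_two hM hzero hbound t ht ht2

lemma abs_integral_le_of_bound_off_two {F : ℝ → ℝ} {y K C : ℝ} (hy : 1 < y) (hyK : y ≤ K)
    (hC : 0 ≤ C) (h : ∀ t ∈ Ioc 1 y, t ≠ 2 → |F t| ≤ C) :
    |∫ t in (1 : ℝ)..y, F t| ≤ C * K := by
  have hne : ∀ᵐ t ∂(volume : Measure ℝ), t ≠ (2 : ℝ) := Measure.ae_ne _ 2
  have key : ‖∫ t in (1 : ℝ)..y, F t‖ ≤ C * |y - 1| := by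
    refine intervalIntegral.norm_integral_le_of_norm_le_const_ae ?_
    filter_upwards [hne] with t ht2 ht
    rw [uIoc_of_le hy.le] at ht
    exact h t ht ht2
  rw [abs_of_pos (by linarith)] at key
  exact key.trans (mul_le_mul_of_nonneg_left (by linarith) hC)

lemma SatisfiesUnifDerivEq.abs_numerator_le {g : ℝ → ℝ} {y K M : ℝ}
    (hg : SatisfiesUnifDerivEq g) (hM : 0 ≤ M) (hgM : ∀ t ∈ Ioc 2 K, |g t| ≤ M)
    (hy : 1 < y) (hyK : y ≤ K) :
    |(∫ t in (1 : ℝ)..y, 2 * t * g t) + 2| ≤ 2 * K * M * K + 2 := by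
  have hK : 0 < K := by linarith
  have hint : |∫ t in (1 : ℝ)..y, 2 * t * g t| ≤ 2 * K * M * K := by
    refine abs_integral_le_of_bound_off_two hy hyK (by positivity) fun t ht ht2 => ?_
    have hgt := norm_le_of_bound_off_two hM (fun t ht => hg.1 t (Or.inr ht)) hgM t
      ⟨ht.1, ht.2.trans hyK⟩ ht2
    rw [abs_mul, abs_of_pos (by linarith [ht.1] : 0 < 2 * t)]
    exact mul_le_mul (by linarith [ht.2]) hgt (abs_nonneg _) (by linarith)
  calc _ ≤ |∫ t in (1 : ℝ)..y, 2 * t * g t| + |2| := abs_add_le _ _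
    _ ≤ _ := by rw [abs_of_pos (by norm_num : (0 : ℝ) < 2)]; linarith

/-- A bound for the solution of the uniform derivative equation propagates by one unit. -/
lemma SatisfiesUnifDerivEq.abs_le_succ {g : ℝ → ℝ} {K M : ℝ}
    (hg : SatisfiesUnifDerivEq g) (hM : 0 ≤ M) (hgM : ∀ t ∈ Ioc 2 K, |g t| ≤ M) :
    ∀ x ∈ Ioc 2 (K + 1), |g x| ≤ 2 * K * M * K + 2 := by
  intro x hx
  have hy : 1 < x - 1 := by linarith [hx.1]
  have hnum := hg.abs_numerator_le hM hgM hy (by linarith [hx.2])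
  have hgx := hg.2 (x - 1) hy
  rw [sub_add_cancel] at hgx
  rw [hgx, abs_div, abs_of_pos (by positivity : 0 < (x - 1) ^ 2)]
  exact (div_le_self (abs_nonneg _) (one_le_pow₀ hy.le)).trans hnum

/-- The exponential derivative equation rescaled by `2 / lam ^ 2` and written in terms of
`sinh (lam * u) / (lam * u)`. -/
lemma SatisfiesExpDerivEq.eq_rescaled {lam y : ℝ} {f : ℝ → ℝ} (hlam : 0 < lam)
    (hf : SatisfiesExpDerivEq lam f) (hy : 1 < y) :
    f (y + 1) = ((∫ t in (1 : ℝ)..y, 2 * t * (Real.sinh (lam * t) / (lam * t) * f t))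
      + 2 * (Real.sinh (lam * 1) / (lam * 1))) /
        (y ^ 2 * (Real.sinh (lam * (y / 2)) / (lam * (y / 2))) ^ 2) := by
  have hint : ∫ t in (1 : ℝ)..y, lam * Real.sinh (lam * t) * f t =
      lam ^ 2 / 2 * ∫ t in (1 : ℝ)..y, 2 * t * (Real.sinh (lam * t) / (lam * t) * f t) := by
    rw [← intervalIntegral.integral_const_mul]
    refine intervalIntegral.integral_congr fun t ht => ?_
    rw [uIcc_of_le hy.le] at ht
    have ht0 : t ≠ 0 := by linarith [ht.1]
    field_simp
  have hcosh : Real.cosh (lam * y) - 1 = 2 * Real.sinh (lam * (y / 2)) ^ 2 := by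
    have h := Real.cosh_two_mul (lam * (y / 2))
    rw [Real.cosh_sq, show 2 * (lam * (y / 2)) = lam * y by ring] at h
    linarith
  have hsinh : Real.sinh (lam * (y / 2)) ≠ 0 := (Real.sinh_pos_iff.2 (by positivity)).ne'
  have hy0 : y ≠ 0 := by linarith
  rw [hf.2 y hy, hint, hcosh, mul_one]
  field_simp

lemma abs_div_mul_sub_div_le {I J q s δ B E : ℝ} (hq : 1 ≤ q) (hs : 1 ≤ s) (hsδ : s ≤ 1 + δ)
    (hδ : δ ≤ 1) (hI : |I| ≤ B) (hJ : |J - I| ≤ E) :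
    |J / (q * s ^ 2) - I / q| ≤ E + 3 * δ * B := by
  have hs2 : 1 ≤ s ^ 2 := one_le_pow₀ hs
  have hδ0 : 0 ≤ δ := by linarith
  have hs3 : s ^ 2 - 1 ≤ 3 * δ := by nlinarith
  have heq : J / (q * s ^ 2) - I / q = ((J - I) - I * (s ^ 2 - 1)) / (q * s ^ 2) := by
    have : q ≠ 0 := by linarith
    have : s ≠ 0 := by linarith
    field_simp
    ring
  have hden : 1 ≤ q * s ^ 2 := one_le_mul_of_one_le_of_one_le hq hs2
  rw [heq, abs_div, abs_of_pos (by linarith : 0 < q * s ^ 2)]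
  calc _ ≤ |(J - I) - I * (s ^ 2 - 1)| := div_le_self (abs_nonneg _) hden
    _ ≤ |J - I| + |I * (s ^ 2 - 1)| := abs_sub _ _
    _ = |J - I| + |I| * (s ^ 2 - 1) := by rw [abs_mul, abs_of_nonneg (by linarith : 0 ≤ s ^ 2 - 1)]
    _ ≤ E + B * (3 * δ) := by
        have hB : 0 ≤ B := (abs_nonneg _).trans hI
        gcongr
    _ = _ := by ring

/-- Closeness of the two solutions propagates by one unit, up to a constant factor. -/
lemma abs_sub_le_succ {lam K M δ : ℝ} {f g : ℝ → ℝ} (hlam : 0 < lam)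
    (hf : SatisfiesExpDerivEq lam f) (hfc : ContinuousOn f (Ioi 2))
    (hg : SatisfiesUnifDerivEq g) (hgc : ContinuousOn g (Ioi 2))
    (hM : 0 ≤ M) (hgM : ∀ t ∈ Ioc 2 K, |g t| ≤ M)
    (hδ0 : 0 ≤ δ) (hδ1 : δ ≤ 1)
    (hs : ∀ u ∈ Ioc 0 K, Real.sinh (lam * u) ≤ (1 + δ) * (lam * u))
    (hfg : ∀ t ∈ Ioc 2 K, |f t - g t| ≤ δ) :
    ∀ x ∈ Ioc 2 (K + 1), |f x - g x| ≤
      (2 * K * (2 + M) * K + 2 + 3 * (2 * K * M * K + 2)) * δ := by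
  intro x hx
  obtain ⟨y, rfl⟩ : ∃ y, x = y + 1 := ⟨x - 1, by ring⟩
  have hy : 1 < y := by linarith [hx.1]
  have hyK : y ≤ K := by linarith [hx.2]
  have hK : 0 < K := by linarith
  set s : ℝ → ℝ := fun u => Real.sinh (lam * u) / (lam * u)
  have hs1 : ∀ u, 0 < u → 1 ≤ s u := fun u hu => by
    have hu' : 0 < lam * u := mul_pos hlam hu
    exact (one_le_div hu').2 (Real.self_le_sinh_iff.2 hu'.le)
  have hs2 : ∀ u ∈ Ioc 0 K, s u ≤ 1 + δ := fun u hu =>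
    (div_le_iff₀ (mul_pos hlam hu.1)).2 (hs u hu)
  have hfzero : ∀ t ∈ Ioo (1 : ℝ) 2, f t = 0 := fun t ht => hf.1 t (Or.inr ht)
  have hgzero : ∀ t ∈ Ioo (1 : ℝ) 2, g t = 0 := fun t ht => hg.1 t (Or.inr ht)
  have hfint : IntervalIntegrable f volume 1 y := by
    refine intervalIntegrable_of_vanishing_of_bound (M := δ + M) hy.le (by positivity)
      hfzero hfc fun t ht => ?_
    have ht' : t ∈ Ioc 2 K := ⟨ht.1, ht.2.trans hyK⟩
    calc |f t| = |(f t - g t) + g t| := by rw [sub_add_cancel]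
      _ ≤ |f t - g t| + |g t| := abs_add_le _ _
      _ ≤ δ + M := add_le_add (hfg t ht') (hgM t ht')
  have hgint : IntervalIntegrable g volume 1 y :=
    intervalIntegrable_of_vanishing_of_bound hy.le hM hgzero hgc
      fun t ht => hgM t ⟨ht.1, ht.2.trans hyK⟩
  have hscont : ContinuousOn s (uIcc 1 y) := by
    refine ContinuousOn.div (by fun_prop) (by fun_prop) fun t ht => ?_
    rw [uIcc_of_le hy.le] at ht
    exact (mul_pos hlam (by linarith [ht.1])).ne'
  have hJint : IntervalIntegrable (fun t => 2 * t * (s t * f t)) volume 1 y :=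
    (hfint.continuousOn_mul hscont).continuousOn_mul (by fun_prop)
  have hIint : IntervalIntegrable (fun t => 2 * t * g t) volume 1 y :=
    hgint.continuousOn_mul (by fun_prop)
  have hdiff : |∫ t in (1 : ℝ)..y, (2 * t * (s t * f t) - 2 * t * g t)| ≤
      2 * K * (2 * δ + δ * M) * K := by
    refine abs_integral_le_of_bound_off_two hy hyK (by positivity) fun t ht ht2 => ?_
    have ht' : t ∈ Ioc 1 K := ⟨ht.1, ht.2.trans hyK⟩
    have ht0 : 0 < t := by linarith [ht.1]
    have hgt := norm_le_of_bound_off_two hM hgzero hgM t ht' ht2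
    have hfgt := norm_le_of_bound_off_two (f := fun t => f t - g t) hδ0
      (fun t ht => by simp [hfzero t ht, hgzero t ht]) hfg t ht' ht2
    have h1 := hs1 t ht0
    have h2 := hs2 t ⟨ht0, ht'.2⟩
    have hclose : |s t * f t - g t| ≤ 2 * δ + δ * M := by
      calc |s t * f t - g t| = |s t * (f t - g t) + (s t - 1) * g t| := by ring_nf
        _ ≤ |s t * (f t - g t)| + |(s t - 1) * g t| := abs_add_le _ _
        _ = s t * |f t - g t| + (s t - 1) * |g t| := by
            rw [abs_mul, abs_mul, abs_of_nonneg (by linarith : 0 ≤ s t),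
              abs_of_nonneg (by linarith : 0 ≤ s t - 1)]
        _ ≤ 2 * δ + δ * M := by
            gcongr <;> linarith
    rw [← mul_sub, abs_mul, abs_of_pos (by linarith : 0 < 2 * t)]
    exact mul_le_mul (by linarith [ht'.2]) hclose (abs_nonneg _) (by linarith)
  have hJI : |((∫ t in (1 : ℝ)..y, 2 * t * (s t * f t)) + 2 * s 1) -
      ((∫ t in (1 : ℝ)..y, 2 * t * g t) + 2)| ≤ 2 * K * (2 * δ + δ * M) * K + 2 * δ := by
    rw [intervalIntegral.integral_sub hJint hIint] at hdiff
    have h1 := hs1 1 one_pos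
    have h2 := hs2 1 ⟨one_pos, by linarith⟩
    rw [abs_le] at hdiff ⊢
    constructor <;> linarith [hdiff.1, hdiff.2]
  have hmain := abs_div_mul_sub_div_le (one_le_pow₀ hy.le : 1 ≤ y ^ 2)
    (hs1 (y / 2) (by linarith)) (hs2 (y / 2) ⟨by linarith, by linarith⟩) hδ1
    (hg.abs_numerator_le hM hgM hy hyK) hJI
  rw [hf.eq_rescaled hlam hy, hg.2 y hy]
  exact hmain.trans_eq (by ring)

/-- **Lemma 2 of the paper.** The solutions `N_λ` of the exponential derivative
equation converge, as `λ → 0⁺`, to the solution `N` of the uniform derivative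
equation, uniformly on every compact piece `(2, n]`. -/
theorem expDeriv_tendsto_unifDeriv_on_compacts
    (Nf : ℝ → ℝ → ℝ) (N : ℝ → ℝ)
    (hNf : ∀ lam : ℝ, 0 < lam → SatisfiesExpDerivEq lam (Nf lam))
    (hNfpos : ∀ lam : ℝ, 0 < lam → ∀ x : ℝ, 0 ≤ Nf lam x)
    (hNfcont : ∀ lam : ℝ, 0 < lam → ContinuousOn (Nf lam) (Set.Ioi 2))
    (hN : SatisfiesUnifDerivEq N)
    (hNcont : ContinuousOn N (Set.Ioi 2)) :
    ∀ n : ℝ, 2 ≤ n →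
      Tendsto (fun lam : ℝ => sSup ((fun x => |Nf lam x - N x|) '' Set.Ioc 2 n))
        (nhdsWithin 0 (Set.Ioi 0)) (nhds 0) := by
  have key : ∀ k : ℕ, (∃ M, 0 ≤ M ∧ ∀ x ∈ Ioc 2 ((k : ℝ) + 2), |N x| ≤ M) ∧
      ∀ ε > 0, ∀ᶠ lam : ℝ in 𝓝[>] 0, ∀ x ∈ Ioc 2 ((k : ℝ) + 2), |Nf lam x - N x| ≤ ε := by
    intro k
    induction k with
    | zero => exact ⟨⟨0, le_rfl, by simp⟩, by simp⟩
    | succ k ih =>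
      obtain ⟨⟨M, hM, hNM⟩, hclose⟩ := ih
      have hk : ((k + 1 : ℕ) : ℝ) + 2 = ((k : ℝ) + 2) + 1 := by push_cast; ring
      rw [hk]
      set K : ℝ := (k : ℝ) + 2
      have hK : 0 < K := by positivity
      refine ⟨⟨_, by positivity, hN.abs_le_succ hM hNM⟩, fun ε hε => ?_⟩
      set D : ℝ := 2 * K * (2 + M) * K + 2 + 3 * (2 * K * M * K + 2)
      have hD : 0 < D := by positivity
      have hδ : 0 < min 1 (ε / D) := lt_min one_pos (div_pos hε hD)
      filter_upwards [hclose _ hδ, eventually_sinh_mul_le hK hδ, self_mem_nhdsWithin]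
        with lam h1 h2 hlam x hx
      refine (abs_sub_le_succ hlam (hNf lam hlam) (hNfcont lam hlam) hN hNcont hM hNM hδ.le
        (min_le_left _ _) h2 h1 x hx).trans ?_
      calc D * min 1 (ε / D) ≤ D * (ε / D) := by gcongr; exact min_le_right _ _
        _ = ε := by field_simp
  intro n _
  obtain ⟨k, hk⟩ := exists_nat_ge n
  rw [Metric.tendsto_nhds]
  intro ε hε
  filter_upwards [(key k).2 (ε / 2) (half_pos hε)] with lam hlam
  have hle : sSup ((fun x => |Nf lam x - N x|) '' Ioc 2 n) ≤ ε / 2 := by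
    refine Real.sSup_le ?_ (half_pos hε).le
    rintro _ ⟨x, hx, rfl⟩
    exact hlam x ⟨hx.1, by linarith [hx.2]⟩
  have hge : 0 ≤ sSup ((fun x => |Nf lam x - N x|) '' Ioc 2 n) := by
    refine Real.sSup_nonneg ?_
    rintro _ ⟨x, _, rfl⟩
    exact abs_nonneg _
  rw [Real.dist_eq, sub_zero, abs_of_nonneg hge]
  linarith
end

section
/- For each λ > 0 let N_λ : ℝ → ℝ satisfy the exponential derivative equation with rate λ, with N_λ ≥ 0 and N_λ continuous on (2,∞), and let N : ℝ → ℝ satisfy the uniform derivative equation, with N continuous on (2,∞). Assume lim_{x→∞} N(x) exists. Then sup_{x > 2} |N_λ(x) − N(x)| → 0 as λ → 0⁺; that is, N_λ converges to N uniformly on (0,∞) away from the points 1 and 2 (on (0,1) ∪ (1,2) both functions vanish). -/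
open MeasureTheory Filter

open Set

/-- `N` vanishes on `(1,2)`, is continuous on `(2,∞)`, and for `x > 1` the value `N (x+1)` is the
`w`-weighted average of `N` over `(0,x]`, up to the contribution `c`. -/
structure WeightedDelayEq (w W : ℝ → ℝ) (c : ℝ) (N : ℝ → ℝ) : Prop where
  continuous_weight : Continuous w
  weight_nonneg : ∀ t, 1 ≤ t → 0 ≤ w t
  hasDerivAt : ∀ x, HasDerivAt W (w x) x
  pos : ∀ x, 1 ≤ x → 0 < W x
  eq_zero : ∀ x, 1 < x → x < 2 → N x = 0
  eq_div : ∀ x, 1 < x → N (x + 1) = ((∫ t in (1 : ℝ)..x, w t * N t) + c) / W x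
  continuousOn : ContinuousOn N (Ioi 2)

namespace WeightedDelayEq

variable {w W N : ℝ → ℝ} {c : ℝ}

theorem apply_of_mem_Ioc (h : WeightedDelayEq w W c N) {x : ℝ} (hx : x ∈ Ioc (2 : ℝ) 3) :
    N x = c / W (x - 1) := by
  have key := h.eq_div (x - 1) (by linarith [hx.1])
  have hzero : ∫ t in (1 : ℝ)..(x - 1), w t * N t = 0 := by
    rw [intervalIntegral.integral_of_le (by linarith [hx.1]), integral_Ioc_eq_integral_Ioo]
    refine setIntegral_eq_zero_of_forall_eq_zero fun t ht => ?_
    rw [h.eq_zero t ht.1 (by linarith [ht.2, hx.2]), mul_zero]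
  rwa [hzero, zero_add, sub_add_cancel] at key

theorem intervalIntegrable (h : WeightedDelayEq w W c N) {f : ℝ → ℝ} (hf : Continuous f)
    {a b : ℝ} (ha : 1 ≤ a) (hb : 1 ≤ b) :
    IntervalIntegrable (fun t => f t * N t) volume a b := by
  have hW : Continuous W := continuous_iff_continuousAt.2 fun x => (h.hasDerivAt x).continuousAt
  have h₁ : IntervalIntegrable N volume 1 2 := by
    refine (intervalIntegrable_const (c := (0 : ℝ))).congr_uIoo fun t ht => ?_
    rw [uIoo_of_le one_le_two] at ht
    exact (h.eq_zero t ht.1 ht.2).symm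
  have h₂ : IntervalIntegrable N volume 2 3 := by
    have hc : ContinuousOn (fun t => c / W (t - 1)) (uIcc 2 3) := by
      refine continuousOn_const.div (by fun_prop) fun t ht => ?_
      rw [uIcc_of_le (by norm_num)] at ht
      exact (h.pos _ (by linarith [ht.1])).ne'
    refine hc.intervalIntegrable.congr_uIoo fun t ht => ?_
    rw [uIoo_of_le (by norm_num)] at ht
    exact (h.apply_of_mem_Ioc ⟨ht.1, ht.2.le⟩).symm
  have h₃ {x : ℝ} (hx : 1 ≤ x) : IntervalIntegrable N volume 1 x := by
    have hm : IntervalIntegrable N volume 3 (max x 3) := by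
      refine (h.continuousOn.mono fun t ht => ?_).intervalIntegrable
      rw [uIcc_of_le (le_max_right _ _)] at ht
      exact lt_of_lt_of_le (by norm_num) ht.1
    refine ((h₁.trans h₂).trans hm).mono_set ?_
    rw [uIcc_of_le hx, uIcc_of_le (hx.trans (le_max_left _ _))]
    exact Icc_subset_Icc_right (le_max_left _ _)
  exact ((h₃ ha).symm.trans (h₃ hb)).continuousOn_mul hf.continuousOn

theorem integral_weight (h : WeightedDelayEq w W c N) (a b : ℝ) :
    ∫ t in a..b, w t = W b - W a :=
  intervalIntegral.integral_eq_sub_of_hasDerivAt (fun x _ => h.hasDerivAt x)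
    (h.continuous_weight.intervalIntegrable _ _)

theorem mul_apply_add_one (h : WeightedDelayEq w W c N) {x y : ℝ} (hx : 1 < x) (hy : 1 < y) :
    W x * N (x + 1) = W y * N (y + 1) + ∫ t in y..x, w t * N t := by
  rw [h.eq_div x hx, h.eq_div y hy, mul_div_cancel₀ _ (h.pos x hx.le).ne',
    mul_div_cancel₀ _ (h.pos y hy.le).ne',
    ← intervalIntegral.integral_add_adjacent_intervals
      (h.intervalIntegrable h.continuous_weight le_rfl hy.le)
      (h.intervalIntegrable h.continuous_weight hy.le hx.le)]
  ring

/-- A bound on the deviation from a constant over one unit interval propagates forever. -/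
theorem abs_sub_le (h : WeightedDelayEq w W c N) {T L ε : ℝ} (hT : 2 ≤ T)
    (hb : ∀ t ∈ Ioc T (T + 1), |N t - L| ≤ ε) {t : ℝ} (ht : T < t) : |N t - L| ≤ ε := by
  have key : ∀ n : ℕ, ∀ t ∈ Ioc T (T + 1 + n), |N t - L| ≤ ε := by
    intro n
    induction n with
    | zero => simpa using hb
    | succ n ih =>
      intro t ht
      push_cast at ht
      rcases le_or_gt t (T + 1) with h1 | h1
      · exact hb t ⟨ht.1, h1⟩
      obtain ⟨x, rfl⟩ : ∃ x, t = x + 1 := ⟨t - 1, by ring⟩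
      have hTx : T ≤ x := by linarith
      have hWx := h.pos x (by linarith)
      have hw : ∀ s ∈ Ioc T x, 0 ≤ w s := fun s hs => h.weight_nonneg s (by linarith [hs.1])
      have hrec := h.mul_apply_add_one (x := x) (y := T) (by linarith) (by linarith)
      have hint : ∫ s in T..x, w s * (N s - L) = (∫ s in T..x, w s * N s) - (W x - W T) * L := by
        have hN := h.intervalIntegrable h.continuous_weight (a := T) (b := x)
          (by linarith) (by linarith)
        have hL : IntervalIntegrable (fun s => w s * L) volume T x :=
          (h.continuous_weight.mul continuous_const).intervalIntegrable _ _
        simp_rw [mul_sub]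
        rw [intervalIntegral.integral_sub hN hL, intervalIntegral.integral_mul_const, h.integral_weight]
      have hle : |∫ s in T..x, w s * (N s - L)| ≤ (W x - W T) * ε := by
        rw [← h.integral_weight, ← intervalIntegral.integral_mul_const, ← Real.norm_eq_abs]
        refine intervalIntegral.norm_integral_le_of_norm_le hTx (.of_forall fun s hs => ?_)
          ((h.continuous_weight.mul continuous_const).intervalIntegrable _ _)
        rw [norm_mul, Real.norm_of_nonneg (hw s hs), Real.norm_eq_abs]
        exact mul_le_mul_of_nonneg_left (ih s ⟨hs.1, by linarith [hs.2, ht.2]⟩) (hw s hs)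
      have hT1 : |W T * (N (T + 1) - L)| ≤ W T * ε := by
        rw [abs_mul, abs_of_pos (h.pos T (by linarith))]
        exact mul_le_mul_of_nonneg_left (hb _ ⟨by linarith, le_rfl⟩) (h.pos T (by linarith)).le
      have heq : W x * (N (x + 1) - L)
          = W T * (N (T + 1) - L) + ∫ s in T..x, w s * (N s - L) := by
        rw [hint]; linear_combination hrec
      refine le_of_mul_le_mul_left ?_ hWx
      calc W x * |N (x + 1) - L| = |W x * (N (x + 1) - L)| := by rw [abs_mul, abs_of_pos hWx]
        _ ≤ W T * ε + (W x - W T) * ε := by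
          rw [heq]; exact (abs_add_le _ _).trans (add_le_add hT1 hle)
        _ = W x * ε := by ring
  obtain ⟨n, hn⟩ := exists_nat_ge (t - (T + 1))
  exact key n t ⟨ht, by linarith⟩

/-- One step of comparison between the solutions of two equations with close normalized weights. -/
theorem abs_apply_add_one_sub_le {w' W' N' : ℝ → ℝ} {c' : ℝ} (h : WeightedDelayEq w W c N)
    (h' : WeightedDelayEq w' W' c' N') (hc : c = w 1) (hc' : c' = w' 1) {x η δ B : ℝ}
    (hx : 1 < x) (hη : 0 ≤ η) (hδ : ∀ t ∈ Icc 1 x, |w t / W x - w' t / W' x| ≤ δ)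
    (hB : ∀ t ∈ Ioi (2 : ℝ), |N' t| ≤ B) (hclose : ∀ t ∈ Ioc 2 x, |N t - N' t| ≤ η) :
    |N (x + 1) - N' (x + 1)| ≤ η + δ * B * (x - 1) + δ := by
  have hWx := h.pos x hx.le
  have hδ0 : 0 ≤ δ := (abs_nonneg _).trans (hδ 1 ⟨le_rfl, hx.le⟩)
  have hB0 : 0 ≤ B := (abs_nonneg _).trans (hB 3 (by norm_num))
  have hint := h.intervalIntegrable (f := fun t => w t / W x) (h.continuous_weight.div_const _)
    le_rfl hx.le
  have hint' := h'.intervalIntegrable (f := fun t => w' t / W' x)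
    (h'.continuous_weight.div_const _) le_rfl hx.le
  have hcongr (v V M : ℝ → ℝ) :
      (∫ t in (1 : ℝ)..x, v t / V x * M t) = (∫ t in (1 : ℝ)..x, v t * M t) / V x := by
    rw [← intervalIntegral.integral_div]
    exact intervalIntegral.integral_congr fun t _ => div_mul_eq_mul_div _ _ _
  have heq : N (x + 1) - N' (x + 1)
      = (∫ t in (1 : ℝ)..x, (w t / W x * N t - w' t / W' x * N' t))
        + (w 1 / W x - w' 1 / W' x) := by
    rw [intervalIntegral.integral_sub hint hint', hcongr, hcongr, h.eq_div x hx,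
      h'.eq_div x hx, hc, hc']
    ring
  have hmajor : Continuous fun t => w t / W x * η + δ * B :=
    ((h.continuous_weight.div_const _).mul continuous_const).add continuous_const
  have hmajor_int : ∫ t in (1 : ℝ)..x, (w t / W x * η + δ * B)
      = (W x - W 1) / W x * η + δ * B * (x - 1) := by
    have hw : IntervalIntegrable (fun t => w t / W x * η) volume 1 x :=
      ((h.continuous_weight.div_const _).mul continuous_const).intervalIntegrable _ _
    rw [intervalIntegral.integral_add hw intervalIntegrable_const, intervalIntegral.integral_mul_const,
      intervalIntegral.integral_div, h.integral_weight, intervalIntegral.integral_const,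
      smul_eq_mul]
    ring
  have hle : |∫ t in (1 : ℝ)..x, (w t / W x * N t - w' t / W' x * N' t)|
      ≤ (W x - W 1) / W x * η + δ * B * (x - 1) := by
    rw [← hmajor_int, ← Real.norm_eq_abs]
    refine intervalIntegral.norm_integral_le_of_norm_le hx.le ?_ (hmajor.intervalIntegrable _ _)
    filter_upwards [Measure.ae_ne volume (2 : ℝ)] with t ht2 ht
    have hp : 0 ≤ w t / W x := div_nonneg (h.weight_nonneg t ht.1.le) hWx.le
    rcases lt_or_gt_of_ne ht2 with hlt | hgt
    · rw [h.eq_zero t ht.1 hlt, h'.eq_zero t ht.1 hlt]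
      simp only [mul_zero, sub_zero, norm_zero]
      positivity
    · have hsplit : w t / W x * N t - w' t / W' x * N' t
          = w t / W x * (N t - N' t) + (w t / W x - w' t / W' x) * N' t := by ring
      rw [hsplit, Real.norm_eq_abs]
      refine (abs_add_le _ _).trans (add_le_add ?_ ?_)
      · rw [abs_mul, abs_of_nonneg hp]
        exact mul_le_mul_of_nonneg_left (hclose t ⟨hgt, ht.2⟩) hp
      · rw [abs_mul]
        exact mul_le_mul (hδ t ⟨ht.1.le, ht.2⟩) (hB t hgt) (abs_nonneg _) hδ0
  have hfrac : (W x - W 1) / W x * η ≤ η := by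
    refine mul_le_of_le_one_left hη ((div_le_one hWx).2 ?_)
    linarith [h.pos 1 le_rfl]
  rw [heq]
  linarith [abs_add_le (∫ t in (1 : ℝ)..x, (w t / W x * N t - w' t / W' x * N' t))
    (w 1 / W x - w' 1 / W' x), hδ 1 ⟨le_rfl, hx.le⟩]

end WeightedDelayEq

theorem SatisfiesExpDerivEq.weightedDelayEq {lam : ℝ} {N : ℝ → ℝ} (hlam : 0 < lam)
    (h : SatisfiesExpDerivEq lam N) (hc : ContinuousOn N (Ioi 2)) :
    WeightedDelayEq (fun t => lam * Real.sinh (lam * t)) (fun x => Real.cosh (lam * x) - 1)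
      (lam * Real.sinh lam) N where
  continuous_weight := by fun_prop
  weight_nonneg t ht := by
    have : 0 ≤ Real.sinh (lam * t) := Real.sinh_nonneg_iff.2 (by positivity)
    positivity
  hasDerivAt x := by
    have := (((hasDerivAt_id x).const_mul lam).cosh).sub_const 1
    simpa [mul_comm] using this
  pos x hx := by
    have : lam * x ≠ 0 := by positivity
    linarith [Real.one_lt_cosh.2 this]
  eq_zero x h1 h2 := h.1 x (.inr ⟨h1, h2⟩)
  eq_div := h.2
  continuousOn := hc

theorem SatisfiesUnifDerivEq.weightedDelayEq {N : ℝ → ℝ}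
    (h : SatisfiesUnifDerivEq N) (hc : ContinuousOn N (Ioi 2)) :
    WeightedDelayEq (fun t => 2 * t) (fun x => x ^ 2) 2 N where
  continuous_weight := by fun_prop
  weight_nonneg t ht := by positivity
  hasDerivAt x := by simpa using hasDerivAt_pow 2 x
  pos x hx := by positivity
  eq_zero x h1 h2 := h.1 x (.inr ⟨h1, h2⟩)
  eq_div := h.2
  continuousOn := hc

theorem SatisfiesUnifDerivEq.abs_le_two {N : ℝ → ℝ}
    (h : SatisfiesUnifDerivEq N) (hc : ContinuousOn N (Ioi 2)) {t : ℝ} (ht : 2 < t) :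
    |N t| ≤ 2 := by
  have hW := h.weightedDelayEq hc
  suffices |N t - 0| ≤ 2 by simpa using this
  refine hW.abs_sub_le le_rfl (fun s hs => ?_) ht
  norm_num at hs
  rw [hW.apply_of_mem_Ioc hs, sub_zero, abs_of_nonneg (by positivity)]
  exact div_le_self (by norm_num) (by nlinarith [hs.1])

theorem Real.sinh_le_mul_cosh {x : ℝ} (hx : 0 ≤ x) : Real.sinh x ≤ x * Real.cosh x := by
  have hmono : MonotoneOn (fun y => y * Real.cosh y - Real.sinh y) (Ici 0) := by
    refine monotoneOn_of_hasDerivWithinAt_nonneg (f' := fun y => y * Real.sinh y) (convex_Ici 0)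
      (by fun_prop) (fun y _ => ?_) fun y hy => ?_
    · have := ((hasDerivAt_id y).mul (Real.hasDerivAt_cosh y)).sub (Real.hasDerivAt_sinh y)
      refine HasDerivAt.hasDerivWithinAt ?_
      exact this.congr_deriv (by simp)
    · rw [interior_Ici] at hy
      exact mul_nonneg hy.le (Real.sinh_nonneg_iff.2 hy.le)
  simpa using hmono self_mem_Ici hx hx

/-- The normalized exponential weight is close to the normalized uniform weight. -/
theorem abs_exp_weight_sub_unif_weight_le {lam t x R : ℝ} (hlam : 0 < lam) (ht : 1 ≤ t)
    (htx : t ≤ x) (hxR : x ≤ R) :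
    |lam * Real.sinh (lam * t) / (Real.cosh (lam * x) - 1) - 2 * t / x ^ 2|
      ≤ 2 * (Real.cosh (lam * R) ^ 2 - 1) := by
  have hx : 0 < x := by linarith
  have ht0 : 0 < t := by linarith
  set C := Real.cosh (lam * R) with hC
  have hC1 : 1 ≤ C := Real.one_le_cosh _
  have hcosh {y : ℝ} (h0 : 0 ≤ y) (hy : y ≤ lam * R) : Real.cosh y ≤ C :=
    Real.cosh_le_cosh.2 (by rwa [abs_of_nonneg h0, abs_of_nonneg (h0.trans hy)])
  have hs1 : lam * t ≤ Real.sinh (lam * t) := Real.self_le_sinh_iff.2 (by positivity)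
  have hs2 : Real.sinh (lam * t) ≤ lam * t * C :=
    (Real.sinh_le_mul_cosh (by positivity)).trans
      (mul_le_mul_of_nonneg_left (hcosh (by positivity) (by gcongr; linarith)) (by positivity))
  have hhalf : Real.cosh (lam * x) - 1 = 2 * Real.sinh (lam * x / 2) ^ 2 := by
    have h1 := Real.cosh_two_mul (lam * x / 2)
    have h2 := Real.cosh_sq (lam * x / 2)
    rw [mul_div_cancel₀ _ two_ne_zero] at h1
    linarith
  have hq1 : lam * x / 2 ≤ Real.sinh (lam * x / 2) := Real.self_le_sinh_iff.2 (by positivity)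
  have hq2 : Real.sinh (lam * x / 2) ≤ lam * x / 2 * C := by
    have hxx : lam * x ≤ lam * R := by gcongr
    have : 0 < lam * x := by positivity
    exact (Real.sinh_le_mul_cosh (by positivity)).trans
      (mul_le_mul_of_nonneg_left (hcosh (by positivity) (by linarith)) (by positivity))
  have hW1 : lam ^ 2 * x ^ 2 / 2 ≤ Real.cosh (lam * x) - 1 := by
    rw [hhalf]
    have := pow_le_pow_left₀ (by positivity) hq1 2
    linarith
  have hW2 : Real.cosh (lam * x) - 1 ≤ lam ^ 2 * x ^ 2 / 2 * C ^ 2 := by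
    rw [hhalf]
    have := pow_le_pow_left₀ (by linarith [show 0 < lam * x / 2 by positivity]) hq2 2
    linarith
  have hWpos : 0 < Real.cosh (lam * x) - 1 := lt_of_lt_of_le (by positivity) hW1
  set r := 2 * t / x ^ 2 with hr
  have hr0 : 0 ≤ r := by positivity
  have hr2 : r ≤ 2 := by
    rw [hr, div_le_iff₀ (by positivity)]
    nlinarith
  have hup : lam * Real.sinh (lam * t) / (Real.cosh (lam * x) - 1) ≤ r * C ^ 2 := by
    rw [div_le_iff₀ hWpos]
    calc lam * Real.sinh (lam * t) ≤ lam * (lam * t * C) := by gcongr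
      _ = r * C * (lam ^ 2 * x ^ 2 / 2) := by rw [hr]; field_simp
      _ ≤ r * C ^ 2 * (lam ^ 2 * x ^ 2 / 2) := by
        gcongr
        nlinarith
      _ ≤ r * C ^ 2 * (Real.cosh (lam * x) - 1) := by gcongr
  have hlow : r / C ^ 2 ≤ lam * Real.sinh (lam * t) / (Real.cosh (lam * x) - 1) := by
    rw [le_div_iff₀ hWpos]
    calc r / C ^ 2 * (Real.cosh (lam * x) - 1)
        ≤ r / C ^ 2 * (lam ^ 2 * x ^ 2 / 2 * C ^ 2) := by gcongr
      _ = lam * (lam * t) := by rw [hr]; field_simp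
      _ ≤ lam * Real.sinh (lam * t) := by gcongr
  have hC2 : 1 ≤ C ^ 2 := one_le_pow₀ hC1
  have hlow' : r * (2 - C ^ 2) ≤ r / C ^ 2 := by
    rw [le_div_iff₀ (by positivity)]
    nlinarith [mul_nonneg hr0 (sq_nonneg (C ^ 2 - 1))]
  rw [abs_le]
  constructor <;> nlinarith

theorem eventually_abs_expDeriv_sub_unifDeriv_le {Nf : ℝ → ℝ → ℝ} {N : ℝ → ℝ}
    (hNf : ∀ lam : ℝ, 0 < lam → SatisfiesExpDerivEq lam (Nf lam))
    (hNfcont : ∀ lam : ℝ, 0 < lam → ContinuousOn (Nf lam) (Ioi 2))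
    (hN : SatisfiesUnifDerivEq N) (hNcont : ContinuousOn N (Ioi 2)) (n : ℕ) {ε : ℝ}
    (hε : 0 < ε) :
    ∀ᶠ lam in nhdsWithin 0 (Ioi 0), ∀ x ∈ Ioc (2 : ℝ) (n + 2), |Nf lam x - N x| ≤ ε := by
  induction n generalizing ε with
  | zero => simp
  | succ n ih =>
    have hlim : Tendsto (fun lam : ℝ => 2 * (Real.cosh (lam * (n + 2)) ^ 2 - 1))
        (nhdsWithin 0 (Ioi 0)) (nhds 0) := by
      refine Tendsto.mono_left ?_ nhdsWithin_le_nhds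
      have : Continuous fun lam : ℝ => 2 * (Real.cosh (lam * (n + 2)) ^ 2 - 1) := by fun_prop
      simpa using this.tendsto 0
    have hpos : 0 < ε / (4 * (n + 2)) := by positivity
    filter_upwards [ih (half_pos hε), hlim.eventually_lt_const hpos, self_mem_nhdsWithin]
      with lam hclose hsmall hlam y hy
    obtain ⟨x, rfl⟩ : ∃ x, y = x + 1 := ⟨y - 1, by ring⟩
    push_cast at hy
    have hx : 1 < x := by linarith [hy.1]
    have hxn : x ≤ n + 2 := by linarith [hy.2]
    have hstep := ((hNf lam hlam).weightedDelayEq hlam (hNfcont lam hlam)).abs_apply_add_one_sub_le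
      (hN.weightedDelayEq hNcont) (by simp) (by simp) hx (half_pos hε).le
      (fun t ht => (abs_exp_weight_sub_unif_weight_le hlam ht.1 ht.2 hxn).trans hsmall.le)
      (fun t ht => hN.abs_le_two hNcont ht) (fun t ht => hclose t ⟨ht.1, ht.2.trans hxn⟩)
    have hmul : ε / (4 * (n + 2)) * (2 * (x - 1) + 1) ≤ ε / (4 * (n + 2)) * (2 * (n + 2)) := by
      gcongr
      linarith
    have hval : ε / (4 * (n + 2)) * (2 * (n + 2)) = ε / 2 := by
      field_simp
      norm_num
    linarith

/-- **Theorem 2 of the paper.** If moreover `lim_{x→∞} N x` exists, then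
the convergence `N_λ → N` as `λ → 0⁺` is uniform on all of `(2, ∞)`. -/
theorem expDeriv_tendsto_unifDeriv_uniform
    (Nf : ℝ → ℝ → ℝ) (N : ℝ → ℝ)
    (hNf : ∀ lam : ℝ, 0 < lam → SatisfiesExpDerivEq lam (Nf lam))
    (hNfpos : ∀ lam : ℝ, 0 < lam → ∀ x : ℝ, 0 ≤ Nf lam x)
    (hNfcont : ∀ lam : ℝ, 0 < lam → ContinuousOn (Nf lam) (Set.Ioi 2))
    (hN : SatisfiesUnifDerivEq N)
    (hNcont : ContinuousOn N (Set.Ioi 2))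
    (hNlim : ∃ L : ℝ, Tendsto N atTop (nhds L)) :
    Tendsto (fun lam : ℝ => sSup ((fun x => |Nf lam x - N x|) '' Set.Ioi 2))
      (nhdsWithin 0 (Set.Ioi 0)) (nhds 0) := by
  obtain ⟨L, hL⟩ := hNlim
  rw [Metric.tendsto_nhds]
  intro ε hε
  obtain ⟨T₀, hT₀⟩ := Filter.eventually_atTop.1 (Metric.tendsto_nhds.1 hL (ε / 6) (by positivity))
  obtain ⟨n, hn⟩ := exists_nat_ge (max T₀ 2)
  have hnT : T₀ ≤ n := (le_max_left _ _).trans hn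
  have hn2 : (2 : ℝ) ≤ n := (le_max_right _ _).trans hn
  filter_upwards [eventually_abs_expDeriv_sub_unifDeriv_le hNf hNfcont hN hNcont n
    (show 0 < ε / 6 by positivity), self_mem_nhdsWithin] with lam hclose hlam
  have hNL : ∀ t : ℝ, n < t → |N t - L| ≤ ε / 6 := fun t ht => by
    have := hT₀ t (hnT.trans ht.le)
    rw [Real.dist_eq] at this
    exact this.le
  have htail : ∀ t : ℝ, n < t → |Nf lam t - L| ≤ ε / 3 := fun t ht =>
    ((hNf lam hlam).weightedDelayEq hlam (hNfcont lam hlam)).abs_sub_le hn2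
      (fun s hs => by
        linarith [abs_sub_le (Nf lam s) (N s) L, hNL s hs.1,
          hclose s ⟨by linarith [hs.1], by linarith [hs.2]⟩]) ht
  have hbound : ∀ x ∈ Set.Ioi (2 : ℝ), |Nf lam x - N x| ≤ ε / 2 := fun x hx => by
    rcases le_or_gt x n with hxn | hxn
    · linarith [hclose x ⟨hx, by linarith⟩]
    · linarith [abs_sub_le (Nf lam x) L (N x), htail x hxn, hNL x hxn, abs_sub_comm L (N x)]
  have hsup : sSup ((fun x => |Nf lam x - N x|) '' Set.Ioi 2) ≤ ε / 2 :=
    Real.sSup_le (Set.forall_mem_image.2 hbound) (by positivity)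
  have hsup0 : 0 ≤ sSup ((fun x => |Nf lam x - N x|) '' Set.Ioi 2) :=
    Real.sSup_nonneg (Set.forall_mem_image.2 fun x _ => abs_nonneg _)
  rw [Real.dist_eq, sub_zero, abs_of_nonneg hsup0]
  linarith
end

section
/- Let λ > 0 and let N : ℝ → ℝ satisfy the exponential derivative equation with rate λ, with N continuous on (2,∞). Then for every x ≥ 3, inf_{x−1 ≤ t ≤ x} N(t) ≤ inf_{x ≤ t ≤ x+1} N(t) ≤ sup_{x ≤ t ≤ x+1} N(t) ≤ sup_{x−1 ≤ t ≤ x} N(t). -/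
open MeasureTheory Filter

open Set intervalIntegral

theorem integral_mul_sinh (lam a b : ℝ) :
    ∫ t in a..b, lam * Real.sinh (lam * t) = Real.cosh (lam * b) - Real.cosh (lam * a) := by
  refine integral_eq_sub_of_hasDerivAt (f := fun t => Real.cosh (lam * t)) (fun t _ => ?_)
    (Continuous.intervalIntegrable (by fun_prop) _ _)
  simpa [mul_comm] using ((hasDerivAt_id t).const_mul lam).cosh

theorem cosh_mul_sub_one_pos {lam : ℝ} (hlam : 0 < lam) {x : ℝ} (hx : 0 < x) :
    0 < Real.cosh (lam * x) - 1 :=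
  sub_pos.2 (Real.one_lt_cosh.2 (mul_pos hlam hx).ne')

theorem mul_sinh_nonneg {lam : ℝ} (hlam : 0 < lam) {t : ℝ} (ht : 0 ≤ t) :
    0 ≤ lam * Real.sinh (lam * t) :=
  mul_nonneg hlam.le (Real.sinh_nonneg_iff.2 (mul_nonneg hlam.le ht))

namespace SatisfiesExpDerivEq

variable {lam : ℝ} {N : ℝ → ℝ}

theorem intervalIntegrable_one_two (hN : SatisfiesExpDerivEq lam N) :
    IntervalIntegrable N volume 1 2 := by
  refine (intervalIntegrable_const (c := (0 : ℝ))).congr_ae ?_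
  rw [uIoc_of_le one_le_two, ← restrict_Ioo_eq_restrict_Ioc]
  filter_upwards [ae_restrict_mem measurableSet_Ioo] with t ht
  exact (hN.1 t (Or.inr ht)).symm

theorem exists_continuousOn_eqOn (hlam : 0 < lam) (hN : SatisfiesExpDerivEq lam N) :
    ∃ F : ℝ → ℝ, ContinuousOn F (Icc 2 3) ∧ EqOn F N (Ioc 2 3) := by
  refine ⟨fun t => ((∫ s in (1 : ℝ)..(t - 1), lam * Real.sinh (lam * s) * N s)
    + lam * Real.sinh lam) / (Real.cosh (lam * (t - 1)) - 1), ?_, fun t ht => ?_⟩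
  · have hg : IntervalIntegrable (fun s => lam * Real.sinh (lam * s) * N s) volume 1 2 :=
      hN.intervalIntegrable_one_two.continuousOn_mul (by fun_prop)
    have hprim := continuousOn_primitive_interval' hg left_mem_uIcc
    rw [uIcc_of_le one_le_two] at hprim
    refine ContinuousOn.div (ContinuousOn.add ?_ continuousOn_const) (by fun_prop) fun t ht =>
      (cosh_mul_sub_one_pos hlam (by linarith [ht.1])).ne'
    exact hprim.comp (f := fun t : ℝ => t - 1) (by fun_prop)
      fun t ht => ⟨by linarith [ht.1], by linarith [ht.2]⟩
  · have := hN.2 (t - 1) (by linarith [ht.1])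
    rw [sub_add_cancel] at this
    exact this.symm

theorem intervalIntegrable_one (hlam : 0 < lam) (hN : SatisfiesExpDerivEq lam N)
    (hNcont : ContinuousOn N (Ioi 2)) {b : ℝ} (hb : 1 ≤ b) :
    IntervalIntegrable N volume 1 b := by
  obtain ⟨F, hF, hFN⟩ := hN.exists_continuousOn_eqOn hlam
  have h23 : IntervalIntegrable N volume 2 3 := by
    have hFi : IntervalIntegrable F volume 2 3 :=
      ContinuousOn.intervalIntegrable (by rwa [uIcc_of_le (by norm_num)])
    refine hFi.congr ?_
    rwa [uIoc_of_le (by norm_num)]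
  have h3 : IntervalIntegrable N volume 3 (max 3 b) := by
    refine ContinuousOn.intervalIntegrable (hNcont.mono fun t ht => ?_)
    rw [uIcc_of_le (le_max_left _ _)] at ht
    exact lt_of_lt_of_le (by norm_num) ht.1
  refine ((hN.intervalIntegrable_one_two.trans h23).trans h3).mono_set ?_
  rw [uIcc_of_le hb, uIcc_of_le (hb.trans (le_max_right _ _))]
  exact Icc_subset_Icc_right (le_max_right _ _)

theorem isBounded_image_Icc (hlam : 0 < lam) (hN : SatisfiesExpDerivEq lam N)
    (hNcont : ContinuousOn N (Ioi 2)) {a : ℝ} (ha : 2 ≤ a) (b : ℝ) :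
    Bornology.IsBounded (N '' Icc a b) := by
  obtain ⟨F, hF, hFN⟩ := hN.exists_continuousOn_eqOn hlam
  have hc : ContinuousOn N (Icc 3 b) :=
    hNcont.mono fun t ht => lt_of_lt_of_le (by norm_num) ht.1
  refine (((isCompact_Icc.image_of_continuousOn hF).isBounded.union
    (isCompact_Icc.image_of_continuousOn hc).isBounded).insert (N 2)).subset ?_
  rintro _ ⟨t, ht, rfl⟩
  rcases (ha.trans ht.1).eq_or_lt with rfl | h2
  · exact mem_insert _ _
  · rcases le_total t 3 with h3 | h3
    · exact Or.inr (Or.inl ⟨t, ⟨h2.le, h3⟩, hFN ⟨h2, h3⟩⟩)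
    · exact Or.inr (Or.inr ⟨t, ⟨h3, ht.2⟩, rfl⟩)

theorem mul_eq_add_integral (hlam : 0 < lam) (hN : SatisfiesExpDerivEq lam N)
    (hNcont : ContinuousOn N (Ioi 2)) {a b : ℝ} (ha : 1 < a) (hb : 1 < b) :
    N (b + 1) * (Real.cosh (lam * b) - 1) = N (a + 1) * (Real.cosh (lam * a) - 1)
      + ∫ t in a..b, lam * Real.sinh (lam * t) * N t := by
  have hg : ∀ {c : ℝ}, 1 < c →
      IntervalIntegrable (fun s => lam * Real.sinh (lam * s) * N s) volume 1 c := fun hc =>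
    (hN.intervalIntegrable_one hlam hNcont hc.le).continuousOn_mul (by fun_prop)
  rw [hN.2 a ha, hN.2 b hb,
    div_mul_cancel₀ _ (cosh_mul_sub_one_pos hlam (by linarith)).ne',
    div_mul_cancel₀ _ (cosh_mul_sub_one_pos hlam (by linarith)).ne',
    ← integral_add_adjacent_intervals (hg ha) ((hg ha).symm.trans (hg hb))]
  ring

theorem mem_Icc_of_forall_mem_Icc (hlam : 0 < lam) (hN : SatisfiesExpDerivEq lam N)
    (hNcont : ContinuousOn N (Ioi 2)) {x m M : ℝ} (hx : 2 < x)
    (h : ∀ t ∈ Icc (x - 1) x, N t ∈ Icc m M) {t : ℝ} (ht : t ∈ Icc x (x + 1)) :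
    N t ∈ Icc m M := by
  obtain ⟨y, rfl⟩ : ∃ y, t = y + 1 := ⟨t - 1, by ring⟩
  have hxy : x - 1 ≤ y := by linarith [ht.1]
  have hyx : y ≤ x := by linarith [ht.2]
  have key := hN.mul_eq_add_integral hlam hNcont (a := x - 1) (b := y)
    (by linarith) (by linarith)
  rw [sub_add_cancel] at key
  have hNx := h x ⟨by linarith, le_rfl⟩
  have hCx := cosh_mul_sub_one_pos hlam (x := x - 1) (by linarith)
  have hCy := cosh_mul_sub_one_pos hlam (x := y) (by linarith)
  have hg : IntervalIntegrable (fun s => lam * Real.sinh (lam * s) * N s) volume (x - 1) y :=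
    ((hN.intervalIntegrable_one hlam hNcont (by linarith)).symm.trans
      (hN.intervalIntegrable_one hlam hNcont (by linarith))).continuousOn_mul (by fun_prop)
  have hconst : ∀ c : ℝ,
      IntervalIntegrable (fun s => lam * Real.sinh (lam * s) * c) volume (x - 1) y :=
    fun c => Continuous.intervalIntegrable (by fun_prop) _ _
  have hlow := integral_mono_on hxy (hconst m) hg fun s hs =>
    mul_le_mul_of_nonneg_left (h s ⟨hs.1, hs.2.trans hyx⟩).1
      (mul_sinh_nonneg hlam (by linarith [hs.1]))
  have hupp := integral_mono_on hxy hg (hconst M) fun s hs =>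
    mul_le_mul_of_nonneg_left (h s ⟨hs.1, hs.2.trans hyx⟩).2
      (mul_sinh_nonneg hlam (by linarith [hs.1]))
  rw [intervalIntegral.integral_mul_const, integral_mul_sinh] at hlow hupp
  constructor
  · refine le_of_mul_le_mul_right ?_ hCy
    nlinarith [mul_le_mul_of_nonneg_right hNx.1 hCx.le]
  · refine le_of_mul_le_mul_right ?_ hCy
    nlinarith [mul_le_mul_of_nonneg_right hNx.2 hCx.le]

end SatisfiesExpDerivEq

/-- **Formula (9) of the paper.** For a solution of the exponential derivative
equation, for every `x ≥ 3` the one-step infima increase and one-step suprema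
decrease. -/
theorem expDeriv_inf_sup_monotone
    (lam : ℝ) (hlam : 0 < lam) (N : ℝ → ℝ)
    (hN : SatisfiesExpDerivEq lam N)
    (hNcont : ContinuousOn N (Set.Ioi 2)) :
    ∀ x : ℝ, 3 ≤ x →
      sInf (N '' Set.Icc (x - 1) x) ≤ sInf (N '' Set.Icc x (x + 1)) ∧
      sInf (N '' Set.Icc x (x + 1)) ≤ sSup (N '' Set.Icc x (x + 1)) ∧
      sSup (N '' Set.Icc x (x + 1)) ≤ sSup (N '' Set.Icc (x - 1) x) := by
  intro x hx
  have hb := hN.isBounded_image_Icc hlam hNcont (a := x - 1) (by linarith) x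
  have hb' := hN.isBounded_image_Icc hlam hNcont (a := x) (by linarith) (x + 1)
  have hne : (N '' Icc x (x + 1)).Nonempty := (nonempty_Icc.2 (by linarith)).image N
  have hmem : ∀ t ∈ Icc x (x + 1),
      N t ∈ Icc (sInf (N '' Icc (x - 1) x)) (sSup (N '' Icc (x - 1) x)) := fun t ht =>
    hN.mem_Icc_of_forall_mem_Icc hlam hNcont (by linarith)
      (fun s hs => ⟨csInf_le hb.bddBelow (mem_image_of_mem N hs),
        le_csSup hb.bddAbove (mem_image_of_mem N hs)⟩) ht
  exact ⟨le_csInf hne (forall_mem_image.2 fun t ht => (hmem t ht).1),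
    csInf_le_csSup hne hb'.bddBelow hb'.bddAbove,
    csSup_le hne (forall_mem_image.2 fun t ht => (hmem t ht).2)⟩
end

section
/- Let λ > 0 and let M : ℝ → ℝ satisfy the exponential parking equation with rate λ. If M is continuously differentiable on (2,∞), then its derivative satisfies, for every x > 1, (cosh(λx) − 1) · M′(x+1) = ∫₁ˣ λ sinh(λt) M′(t) dt + λ sinh(λ). -/
open MeasureTheory Filter

/-- `M` satisfies the exponential parking equation with rate `lam`:
`M = 0` on `[0,1]` and for every `x > 0`,
`M (x+1) = ∫₀ˣ (lam * e^{-lam t} / (1 - e^{-lam x})) * (M t + M (x - t)) dt + 1`. -/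
def SatisfiesExpParkingEq (lam : ℝ) (M : ℝ → ℝ) : Prop :=
  (∀ x : ℝ, 0 ≤ x → x ≤ 1 → M x = 0) ∧
  ∀ x : ℝ, 0 < x →
    M (x + 1) = (∫ t in (0:ℝ)..x,
      (lam * Real.exp (-lam * t) / (1 - Real.exp (-lam * x))) * (M t + M (x - t))) + 1

open intervalIntegral Set Topology

namespace SatisfiesExpParkingEq

variable {lam : ℝ} {M : ℝ → ℝ}

theorem eq_one (hM : SatisfiesExpParkingEq lam M) {y : ℝ} (hy : 1 < y) (hy2 : y ≤ 2) :
    M y = 1 := by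
  have h := hM.2 (y - 1) (by linarith)
  have h0 : EqOn (fun t ↦ (lam * Real.exp (-lam * t) / (1 - Real.exp (-lam * (y - 1)))) *
      (M t + M (y - 1 - t))) (fun _ ↦ 0) (uIcc 0 (y - 1)) := by
    intro t ht
    rw [uIcc_of_le (by linarith)] at ht
    simp only
    rw [hM.1 t ht.1 (by linarith [ht.2]),
      hM.1 (y - 1 - t) (by linarith [ht.2]) (by linarith [ht.1]), add_zero, mul_zero]
  rw [integral_congr h0] at h
  simpa using h

/-- Integrals of `M` against a continuous weight start at `1`, and there only see a continuous
function `m` agreeing with `M` beyond `1`. -/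
theorem integral_weight_mul (hM : SatisfiesExpParkingEq lam M) {m w : ℝ → ℝ}
    (hm : Continuous m) (hw : Continuous w) {x : ℝ} (hx : 1 ≤ x)
    (hMm : ∀ t, 1 < t → t ≤ x → M t = m t) :
    IntervalIntegrable (fun t ↦ w t * M t) volume 0 x ∧
      ∫ t in (0 : ℝ)..x, w t * M t = ∫ t in (1 : ℝ)..x, w t * m t := by
  have h0 : EqOn (fun _ ↦ (0 : ℝ)) (fun t ↦ w t * M t) (uIoc 0 1) := by
    intro t ht
    rw [uIoc_of_le zero_le_one] at ht
    simp [hM.1 t ht.1.le ht.2]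
  have h1 : EqOn (fun t ↦ w t * m t) (fun t ↦ w t * M t) (uIoc 1 x) := by
    intro t ht
    rw [uIoc_of_le hx] at ht
    simp [hMm t ht.1 ht.2]
  have i0 : IntervalIntegrable (fun t ↦ w t * M t) volume 0 1 :=
    IntervalIntegrable.congr h0 intervalIntegrable_const
  have i1 : IntervalIntegrable (fun t ↦ w t * M t) volume 1 x :=
    IntervalIntegrable.congr h1 ((hw.mul hm).intervalIntegrable _ _)
  refine ⟨i0.trans i1, ?_⟩
  rw [← integral_add_adjacent_intervals i0 i1,
    ← integral_congr_ae (ae_of_all _ h0), ← integral_congr_ae (ae_of_all _ h1)]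
  simp

theorem mul_sub_one_eq (hM : SatisfiesExpParkingEq lam M) (hlam : 0 < lam) {m : ℝ → ℝ}
    (hm : Continuous m) {x : ℝ} (hx : 1 ≤ x) (hMm : ∀ t, 1 < t → t ≤ x → M t = m t) :
    (Real.exp (lam * x) - 1) * (M (x + 1) - 1) =
      Real.exp (lam * x) * (∫ t in (1 : ℝ)..x, lam * Real.exp (-lam * t) * m t) +
        ∫ t in (1 : ℝ)..x, lam * Real.exp (lam * t) * m t := by
  have hE : 1 < Real.exp (lam * x) := Real.one_lt_exp_iff.2 (by positivity)
  have hEE : Real.exp (-lam * x) = (Real.exp (lam * x))⁻¹ := by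
    rw [neg_mul, Real.exp_neg]
  obtain ⟨iA, eA⟩ := hM.integral_weight_mul hm
    (w := fun t ↦ lam * Real.exp (-lam * t)) (by fun_prop) hx hMm
  obtain ⟨iB, eB⟩ := hM.integral_weight_mul hm
    (w := fun t ↦ lam * Real.exp (-lam * (x - t))) (by fun_prop) hx hMm
  have iB' := (iB.comp_sub_left x).symm
  have eB' := integral_comp_sub_left (a := 0) (b := x)
    (fun t ↦ lam * Real.exp (-lam * (x - t)) * M t) x
  simp only [sub_sub_cancel, sub_self, sub_zero] at iB' eB'
  have eB'' : ∫ t in (1 : ℝ)..x, lam * Real.exp (-lam * (x - t)) * m t =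
      Real.exp (-lam * x) * ∫ t in (1 : ℝ)..x, lam * Real.exp (lam * t) * m t := by
    rw [← intervalIntegral.integral_const_mul]
    refine integral_congr fun t _ ↦ ?_
    rw [show -lam * (x - t) = -lam * x + lam * t by ring, Real.exp_add]
    ring
  have key : M (x + 1) = (1 - Real.exp (-lam * x))⁻¹ *
      ((∫ t in (0 : ℝ)..x, lam * Real.exp (-lam * t) * M t) +
        ∫ t in (0 : ℝ)..x, lam * Real.exp (-lam * t) * M (x - t)) + 1 := by
    rw [hM.2 x (by linarith), ← intervalIntegral.integral_add iA iB',
      ← intervalIntegral.integral_const_mul]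
    congr 1
    refine integral_congr fun t _ ↦ ?_
    ring
  rw [key, eA, eB', eB, eB'', hEE]
  have h1 : Real.exp (lam * x) - 1 ≠ 0 := by linarith
  have h2 : Real.exp (lam * x) ≠ 0 := by linarith
  have h3 : 1 - (Real.exp (lam * x))⁻¹ = (Real.exp (lam * x) - 1) / Real.exp (lam * x) := by
    field_simp
  rw [h3]
  field_simp
  ring

/-- Away from its jump at `1`, a differentiable solution is continuous. -/
theorem continuous_ite (hM : SatisfiesExpParkingEq lam M) (hlam : 0 < lam)
    (hdiff : ∀ x ∈ Ioi (2 : ℝ), DifferentiableAt ℝ M x) :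
    Continuous fun t ↦ if t ≤ 1 then 1 else M t := by
  have hlow : EqOn (fun t ↦ if t ≤ 1 then 1 else M t) (fun _ ↦ 1) (Iic 2) := by
    intro t ht
    by_cases h : t ≤ 1
    · simp [h]
    · simp [h, hM.eq_one (not_le.1 h) ht]
  refine continuous_iff_continuousAt.2 fun a ↦ ?_
  rcases lt_trichotomy a 2 with ha | rfl | ha
  · exact continuousAt_const.congr (hlow.eventuallyEq_of_mem (Iic_mem_nhds ha)).symm
  · refine continuousAt_iff_continuous_left_right.2
      ⟨continuousWithinAt_const.congr hlow (hlow self_mem_Iic), ?_⟩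
    let F : ℝ → ℝ := fun y ↦ (Real.exp (lam * (y - 1)) *
      (∫ t in (1 : ℝ)..(y - 1), lam * Real.exp (-lam * t) * 1) +
        ∫ t in (1 : ℝ)..(y - 1), lam * Real.exp (lam * t) * 1) /
          (Real.exp (lam * (y - 1)) - 1) + 1
    have hF : ContinuousAt F 2 := by
      have hA : Continuous fun y : ℝ ↦ ∫ t in (1 : ℝ)..(y - 1), lam * Real.exp (-lam * t) * 1 :=
        (continuous_primitive (fun a b ↦ Continuous.intervalIntegrable (by fun_prop) a b) 1).comp
          (continuous_sub_right 1)
      have hB : Continuous fun y : ℝ ↦ ∫ t in (1 : ℝ)..(y - 1), lam * Real.exp (lam * t) * 1 :=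
        (continuous_primitive (fun a b ↦ Continuous.intervalIntegrable (by fun_prop) a b) 1).comp
          (continuous_sub_right 1)
      refine ContinuousAt.add (ContinuousAt.div ?_ ?_ ?_) continuousAt_const
      · exact Continuous.continuousAt (by fun_prop)
      · exact Continuous.continuousAt (by fun_prop)
      · have : 1 < Real.exp (lam * (2 - 1)) := Real.one_lt_exp_iff.2 (by linarith)
        linarith
    have hMF : ∀ y ∈ Icc (2 : ℝ) 3, (if y ≤ 1 then 1 else M y) = F y := by
      intro y hy
      have h := hM.mul_sub_one_eq hlam (m := fun _ ↦ 1) continuous_const (x := y - 1)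
        (by linarith [hy.1]) (fun t h1 h2 ↦ hM.eq_one h1 (by linarith [hy.2]))
      have hE : 1 < Real.exp (lam * (y - 1)) :=
        Real.one_lt_exp_iff.2 (mul_pos hlam (by linarith [hy.1]))
      have hE' : Real.exp (lam * (y - 1)) - 1 ≠ 0 := by linarith
      rw [if_neg (by linarith [hy.1])]
      simp only [F]
      rw [← h, sub_add_cancel]
      field_simp
      ring
    exact hF.continuousWithinAt.congr_of_eventuallyEq
      (eventuallyEq_of_mem (Icc_mem_nhdsGE (by norm_num)) hMF) (hMF 2 (by norm_num))
  · refine (hdiff a ha).continuousAt.congr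
      (eventuallyEq_of_mem (Ioi_mem_nhds (show 1 < a by linarith)) fun t ht ↦ ?_)
    simp [not_le.2 (mem_Ioi.1 ht)]

theorem cosh_sub_one_mul_deriv (hM : SatisfiesExpParkingEq lam M) (hlam : 0 < lam)
    {m : ℝ → ℝ} (hm : Continuous m) (hMm : ∀ t, 1 < t → M t = m t) {x : ℝ} (hx : 1 < x)
    (hdiff : DifferentiableAt ℝ M (x + 1)) :
    (Real.cosh (lam * x) - 1) * deriv M (x + 1) =
      lam * (Real.sinh (lam * x) * m x) -
        lam * ∫ t in (1 : ℝ)..x, lam * Real.cosh (lam * t) * m t := by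
  have hprim : ∀ w : ℝ → ℝ, Continuous w →
      HasDerivAt (fun y ↦ ∫ t in (1 : ℝ)..y, w t * m t) (w x * m x) x := fun w hw ↦
    ((hw.mul hm).integral_hasStrictDerivAt 1 x).hasDerivAt
  have hA := hprim (fun t ↦ lam * Real.exp (-lam * t)) (by fun_prop)
  have hB := hprim (fun t ↦ lam * Real.exp (lam * t)) (by fun_prop)
  have hE : HasDerivAt (fun y ↦ Real.exp (lam * y)) (Real.exp (lam * x) * (lam * 1)) x :=
    ((hasDerivAt_id x).const_mul lam).exp
  have hL := (hE.sub_const 1).mul ((hdiff.hasDerivAt.comp_add_const x 1).sub_const 1)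
  have hR := (hE.mul hA).add hB
  have hfun := fun y (hy : 1 < y) ↦ hM.mul_sub_one_eq hlam hm hy.le fun t h _ ↦ hMm t h
  have hd := hL.unique (hR.congr_of_eventuallyEq
    (eventuallyEq_of_mem (Ioi_mem_nhds hx) fun y hy ↦ hfun y hy))
  have hv := hfun x hx
  have hC : ∫ t in (1 : ℝ)..x, lam * Real.cosh (lam * t) * m t =
      ((∫ t in (1 : ℝ)..x, lam * Real.exp (-lam * t) * m t) +
        ∫ t in (1 : ℝ)..x, lam * Real.exp (lam * t) * m t) / 2 := by
    rw [← intervalIntegral.integral_add (Continuous.intervalIntegrable (by fun_prop) _ _)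
      (Continuous.intervalIntegrable (by fun_prop) _ _), ← intervalIntegral.integral_div]
    refine integral_congr fun t _ ↦ ?_
    simp only [Real.cosh_eq, neg_mul]
    ring
  have hEE : Real.exp (lam * x) * Real.exp (-(lam * x)) = 1 := by
    rw [← Real.exp_add, add_neg_cancel, Real.exp_zero]
  rw [hC, Real.cosh_eq, Real.sinh_eq]
  simp only [neg_mul] at hd hv ⊢
  generalize (∫ t in (1 : ℝ)..x, lam * Real.exp (-(lam * t)) * m t) = A at *
  generalize (∫ t in (1 : ℝ)..x, lam * Real.exp (lam * t) * m t) = B at *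
  generalize Real.exp (lam * x) = E at *
  generalize Real.exp (-(lam * x)) = E' at *
  linear_combination (1 - E') / 2 * hd - lam / 2 * hv +
    (lam * (M (x + 1) - 1) + deriv M (x + 1) - lam * A - lam * m x * E') / 2 * hEE

theorem eventuallyEq_one (hM : SatisfiesExpParkingEq lam M) {t : ℝ} (h1 : 1 < t) (h2 : t < 2) :
    M =ᶠ[𝓝 t] fun _ ↦ 1 :=
  eventuallyEq_of_mem (Ioo_mem_nhds h1 h2) fun _ hy ↦ hM.eq_one hy.1 hy.2.le

theorem hasDerivAt (hM : SatisfiesExpParkingEq lam M)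
    (hdiff : ∀ x ∈ Ioi (2 : ℝ), DifferentiableAt ℝ M x) {t : ℝ} (h1 : 1 < t) (h2 : t ≠ 2) :
    HasDerivAt M (deriv M t) t := by
  rcases h2.lt_or_gt with h | h
  · exact ((hM.eventuallyEq_one h1 h).differentiableAt_iff.2 (differentiableAt_const _)).hasDerivAt
  · exact (hdiff t h).hasDerivAt

theorem intervalIntegrable_deriv (hM : SatisfiesExpParkingEq lam M) (hlam : 0 < lam)
    (hdiff : ∀ x ∈ Ioi (2 : ℝ), DifferentiableAt ℝ M x)
    {m : ℝ → ℝ} (hm : Continuous m) (hMm : ∀ t, 1 < t → M t = m t) {x : ℝ} (hx : 1 < x) :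
    IntervalIntegrable (deriv M) volume 1 x := by
  have i1 : IntervalIntegrable (deriv M) volume 1 2 := by
    refine IntervalIntegrable.congr_uIoo (f := fun _ ↦ 0) intervalIntegrable_const ?_
    intro t ht
    rw [uIoo_of_le one_le_two] at ht
    rw [(hM.eventuallyEq_one ht.1 ht.2).deriv_eq, deriv_const]
  have hy : 2 ≤ max x 2 := le_max_right _ _
  have i2 : IntervalIntegrable (deriv M) volume 2 (max x 2) := by
    refine IntervalIntegrable.congr_uIoo (f := fun t ↦
      (lam * (Real.sinh (lam * (t - 1)) * m (t - 1)) -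
        lam * ∫ s in (1 : ℝ)..(t - 1), lam * Real.cosh (lam * s) * m s) /
          (Real.cosh (lam * (t - 1)) - 1)) (ContinuousOn.intervalIntegrable ?_) ?_
    · have hC : Continuous fun t : ℝ ↦
          ∫ s in (1 : ℝ)..(t - 1), lam * Real.cosh (lam * s) * m s :=
        (continuous_primitive (fun a b ↦ Continuous.intervalIntegrable (by fun_prop) a b) 1).comp
          (continuous_sub_right 1)
      refine ContinuousOn.div (Continuous.continuousOn (by fun_prop))
        (Continuous.continuousOn (by fun_prop)) fun t ht ↦ ?_
      rw [uIcc_of_le hy] at ht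
      exact sub_ne_zero.2 (Real.one_lt_cosh.2
        (mul_pos hlam (by linarith [ht.1])).ne').ne'
    · intro t ht
      rw [uIoo_of_le hy] at ht
      have h := hM.cosh_sub_one_mul_deriv hlam hm hMm (x := t - 1) (by linarith [ht.1])
        (hdiff _ (by simpa using ht.1))
      rw [sub_add_cancel] at h
      have hne : Real.cosh (lam * (t - 1)) - 1 ≠ 0 := sub_ne_zero.2 (Real.one_lt_cosh.2
        (mul_pos hlam (by linarith [ht.1])).ne').ne'
      simp only
      rw [← h, mul_div_cancel_left₀ _ hne]
  refine (i1.trans i2).mono_set ?_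
  rw [uIcc_of_le hx.le, uIcc_of_le (by linarith)]
  exact Icc_subset_Icc_right (le_max_left _ _)

end SatisfiesExpParkingEq

/-- **Derivation of equation (7) of the paper.** If `M` satisfies the
exponential parking equation with rate `λ` and is continuously differentiable on
`(2,∞)`, then its derivative satisfies, for every `x > 1`,
`(cosh (λx) - 1) * M′(x+1) = ∫₁ˣ λ sinh (λt) M′(t) dt + λ sinh λ`. -/
theorem expParking_deriv_eq
    (lam : ℝ) (hlam : 0 < lam) (M : ℝ → ℝ)
    (hM : SatisfiesExpParkingEq lam M)
    (hdiff : ∀ x ∈ Set.Ioi (2:ℝ), DifferentiableAt ℝ M x)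
    (hderivcont : ContinuousOn (deriv M) (Set.Ioi 2)) :
    ∀ x : ℝ, 1 < x →
      (Real.cosh (lam * x) - 1) * deriv M (x + 1)
        = (∫ t in (1:ℝ)..x, lam * Real.sinh (lam * t) * deriv M t)
          + lam * Real.sinh lam := by
  intro x hx
  set m : ℝ → ℝ := fun t ↦ if t ≤ 1 then 1 else M t with hm_def
  have hm : Continuous m := hM.continuous_ite hlam hdiff
  have hMm : ∀ t, 1 < t → M t = m t := fun t ht ↦ by simp [hm_def, not_le.2 ht]
  have hm1 : m 1 = 1 := by simp [hm_def]
  have iC : IntervalIntegrable (fun t ↦ lam * Real.cosh (lam * t) * m t) volume 1 x :=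
    Continuous.intervalIntegrable (by fun_prop) _ _
  have iS : IntervalIntegrable (fun t ↦ Real.sinh (lam * t) * deriv M t) volume 1 x :=
    (hM.intervalIntegrable_deriv hlam hdiff hm hMm hx).continuousOn_mul
      (Continuous.continuousOn (by fun_prop))
  have hparts := integral_eq_of_hasDerivAt_off_countable_of_le
    (fun t ↦ Real.sinh (lam * t) * m t)
    (fun t ↦ lam * Real.cosh (lam * t) * m t + Real.sinh (lam * t) * deriv M t)
    hx.le (countable_singleton (2 : ℝ)) (Continuous.continuousOn (by fun_prop))
    (fun t ht ↦ by
      have ht1 : 1 < t := ht.1.1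
      have hd : HasDerivAt m (deriv M t) t :=
        (hM.hasDerivAt hdiff ht1 ht.2).congr_of_eventuallyEq
          (eventuallyEq_of_mem (Ioi_mem_nhds ht1) fun y hy ↦ (hMm y hy).symm)
      have hs := ((hasDerivAt_id t).const_mul lam).sinh
      refine (hs.mul hd).congr_deriv ?_
      simp only [id, mul_one]
      ring)
    (iC.add iS)
  rw [intervalIntegral.integral_add iC iS, hm1, mul_one, mul_one] at hparts
  have hS : ∫ t in (1 : ℝ)..x, lam * Real.sinh (lam * t) * deriv M t =
      lam * ∫ t in (1 : ℝ)..x, Real.sinh (lam * t) * deriv M t := by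
    simp only [mul_assoc, intervalIntegral.integral_const_mul]
  rw [hS, hM.cosh_sub_one_mul_deriv hlam hm hMm hx (hdiff _ (by simp only [Set.mem_Ioi]; linarith))]
  linear_combination (-lam) * hparts
end

section
/- Let λ > 0 and let M : ℝ → ℝ be locally integrable and satisfy the exponential parking equation with rate λ. Then M(x) = 1 for all 1 < x ≤ 2, and M(x) = 1 + (1 + e^{−λ})(1 − e^{−λ(x−2)})/(1 − e^{−λ(x−1)}) for all 2 < x ≤ 3. -/
open MeasureTheory Filter

theorem hasDerivAt_neg_exp_neg_mul (lam t : ℝ) :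
    HasDerivAt (fun t => -Real.exp (-lam * t)) (lam * Real.exp (-lam * t)) t := by
  have h : HasDerivAt (fun t : ℝ => -lam * t) (-lam) t := by
    simpa using (hasDerivAt_id t).const_mul (-lam)
  exact h.exp.neg.congr_deriv (by ring)

theorem integral_exp_density (lam a b : ℝ) :
    ∫ t in a..b, lam * Real.exp (-lam * t) = Real.exp (-lam * a) - Real.exp (-lam * b) := by
  rw [intervalIntegral.integral_eq_sub_of_hasDerivAt
    (fun t _ => hasDerivAt_neg_exp_neg_mul lam t)
    ((by fun_prop : Continuous fun t : ℝ => lam * Real.exp (-lam * t)).intervalIntegrable a b)]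
  ring

/-- On an interval where `f` is constant in the interior, the weighted exponential integral
is computed from that constant. -/
theorem intervalIntegrable_and_integral_exp_weight (lam c k a b : ℝ) (hab : a ≤ b) (f : ℝ → ℝ)
    (hf : ∀ t ∈ Set.Ioo a b, f t = k) :
    IntervalIntegrable (fun t => lam * Real.exp (-lam * t) / c * f t) volume a b ∧
    ∫ t in a..b, lam * Real.exp (-lam * t) / c * f t
      = k / c * (Real.exp (-lam * a) - Real.exp (-lam * b)) := by
  have heq : Set.EqOn (fun t => k / c * (lam * Real.exp (-lam * t)))
      (fun t => lam * Real.exp (-lam * t) / c * f t) (Set.uIoo a b) := by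
    intro t ht
    rw [Set.uIoo_of_le hab] at ht
    simp only [hf t ht]
    ring
  have hcont : Continuous fun t : ℝ => k / c * (lam * Real.exp (-lam * t)) := by fun_prop
  refine ⟨(hcont.intervalIntegrable a b).congr_uIoo heq, ?_⟩
  rw [← intervalIntegral.integral_congr_uIoo heq, intervalIntegral.integral_const_mul,
    integral_exp_density]

/-- **Formula (18) of the paper** (method of steps): a locally integrable
solution of the exponential parking equation equals `1` on `(1,2]` and equals
`1 + (1 + e^{-λ})(1 - e^{-λ(x-2)})/(1 - e^{-λ(x-1)})` on `(2,3]`. -/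
theorem expParking_first_steps
    (lam : ℝ) (hlam : 0 < lam) (M : ℝ → ℝ)
    (hloc : LocallyIntegrable M)
    (hM : SatisfiesExpParkingEq lam M) :
    (∀ x : ℝ, 1 < x → x ≤ 2 → M x = 1) ∧
    (∀ x : ℝ, 2 < x → x ≤ 3 →
      M x = 1 + (1 + Real.exp (-lam)) * (1 - Real.exp (-lam * (x - 2)))
        / (1 - Real.exp (-lam * (x - 1)))) := by
  obtain ⟨hzero, hstep⟩ := hM
  have hone : ∀ x : ℝ, 1 < x → x ≤ 2 → M x = 1 := by
    intro x h1 h2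
    have h := hstep (x - 1) (by linarith)
    rw [sub_add_cancel, (intervalIntegrable_and_integral_exp_weight lam _ 0 0 (x - 1)
      (by linarith) (fun t => M t + M (x - 1 - t)) ?_).2] at h
    · simpa using h
    · rintro t ⟨ht0, ht1⟩
      simp [hzero t ht0.le (by linarith), hzero (x - 1 - t) (by linarith) (by linarith)]
  refine ⟨hone, fun x h2 h3 => ?_⟩
  have h := hstep (x - 1) (by linarith)
  rw [sub_add_cancel] at h
  set c := 1 - Real.exp (-lam * (x - 1))
  obtain ⟨i₁, e₁⟩ := intervalIntegrable_and_integral_exp_weight lam c 1 0 (x - 2)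
    (by linarith) (fun t => M t + M (x - 1 - t)) (by
      rintro t ⟨ht0, ht1⟩
      simp [hzero t ht0.le (by linarith), hone (x - 1 - t) (by linarith) (by linarith)])
  obtain ⟨i₂, e₂⟩ := intervalIntegrable_and_integral_exp_weight lam c 0 (x - 2) 1
    (by linarith) (fun t => M t + M (x - 1 - t)) (by
      rintro t ⟨ht0, ht1⟩
      simp [hzero t (by linarith) ht1.le, hzero (x - 1 - t) (by linarith) (by linarith)])
  obtain ⟨i₃, e₃⟩ := intervalIntegrable_and_integral_exp_weight lam c 1 1 (x - 1)
    (by linarith) (fun t => M t + M (x - 1 - t)) (by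
      rintro t ⟨ht0, ht1⟩
      simp [hone t ht0 (by linarith), hzero (x - 1 - t) (by linarith) (by linarith)])
  have hexp : Real.exp (-lam * (x - 1)) = Real.exp (-lam) * Real.exp (-lam * (x - 2)) := by
    rw [← Real.exp_add]
    ring_nf
  rw [h, ← intervalIntegral.integral_add_adjacent_intervals (i₁.trans i₂) i₃,
    ← intervalIntegral.integral_add_adjacent_intervals i₁ i₂, e₁, e₂, e₃, hexp,
    mul_zero, mul_one, Real.exp_zero]
  ring
end

section
/- Let λ > 0 and let M : ℝ → ℝ be measurable with 0 ≤ M(x) ≤ x for all x ≥ 0, satisfying the exponential parking equation with rate λ. Let φ(s) = ∫₀^∞ M(x) e^{−sx} dx for complex s with Re(s) > 0. Then for every complex s with Re(s) > 0 one has e^s(s+λ) − λ ≠ 0 and s² φ(s) · (e^s(s+λ) − λ) = s · (λ + (s+λ)(s e^{s+λ} + λ) φ(s+λ)). -/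
open MeasureTheory Filter

theorem integrableOn_mul_cexp_of_le_id {M : ℝ → ℝ} (hmeas : Measurable M)
    (hbound : ∀ x : ℝ, 0 ≤ x → 0 ≤ M x ∧ M x ≤ x) {s : ℂ} (hs : 0 < s.re) :
    IntegrableOn (fun x : ℝ => (M x : ℂ) * Complex.exp (-s * x)) (Set.Ioi 0) := by
  have hdom : IntegrableOn (fun x : ℝ => x ^ (1 : ℝ) * Real.exp (-s.re * x ^ (1 : ℝ)))
      (Set.Ioi 0) :=
    integrableOn_rpow_mul_exp_neg_mul_rpow (by norm_num) one_pos hs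
  refine Integrable.mono' hdom (Measurable.aestronglyMeasurable (by fun_prop)) ?_
  filter_upwards [ae_restrict_mem measurableSet_Ioi] with x hx
  obtain ⟨h0, h1⟩ := hbound x (le_of_lt hx)
  simp only [norm_mul, Complex.norm_real, Complex.norm_exp, Real.norm_eq_abs, abs_of_nonneg h0,
    Real.rpow_one]
  have hre : (-s * (x : ℂ)).re = -s.re * x := by simp
  rw [hre]
  gcongr

theorem intervalIntegrable_of_le_id {M : ℝ → ℝ} (hmeas : Measurable M)
    (hbound : ∀ x : ℝ, 0 ≤ x → 0 ≤ M x ∧ M x ≤ x) {x : ℝ} (hx : 0 ≤ x) :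
    IntervalIntegrable M volume 0 x := by
  refine (intervalIntegrable_const (c := x)).mono_fun hmeas.aestronglyMeasurable ?_
  filter_upwards [ae_restrict_mem measurableSet_uIoc] with t ht
  rw [Set.uIoc_of_le hx] at ht
  obtain ⟨h0, h1⟩ := hbound t ht.1.le
  rw [Real.norm_eq_abs, Real.norm_eq_abs, abs_of_nonneg h0, abs_of_nonneg hx]
  exact h1.trans ht.2

theorem cexp_mul_add_sub_ne_zero {lam : ℝ} (hlam : 0 < lam) {s : ℂ} (hs : 0 < s.re) :
    Complex.exp s * (s + (lam : ℂ)) - (lam : ℂ) ≠ 0 := by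
  intro h
  have hnorm := congrArg norm (sub_eq_zero.mp h)
  rw [norm_mul, Complex.norm_exp, Complex.norm_real, Real.norm_eq_abs, abs_of_pos hlam] at hnorm
  have h1 : 1 < Real.exp s.re := Real.one_lt_exp_iff.mpr hs
  have h2 : s.re + lam ≤ ‖s + (lam : ℂ)‖ := by
    simpa using Complex.re_le_norm (s + (lam : ℂ))
  nlinarith

theorem integrableOn_and_integral_comp_add_one {F : ℝ → ℂ} (hF : IntegrableOn F (Set.Ioi 0))
    (hzero : ∀ x ∈ Set.Ioc (0 : ℝ) 1, F x = 0) :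
    IntegrableOn (fun x => F (x + 1)) (Set.Ioi 0) ∧
      ∫ x in Set.Ioi (0 : ℝ), F (x + 1) = ∫ x in Set.Ioi (0 : ℝ), F x := by
  have hmp := measurePreserving_add_right (volume : Measure ℝ) 1
  have hemb : MeasurableEmbedding (fun x : ℝ => x + 1) := measurableEmbedding_addRight 1
  have hpre : (fun x : ℝ => x + 1) ⁻¹' Set.Ioi 1 = Set.Ioi 0 := by
    ext x; simp
  have hsub : Set.Ioi (1 : ℝ) ⊆ Set.Ioi 0 := Set.Ioi_subset_Ioi zero_le_one
  constructor
  · rw [← hpre]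
    exact (hmp.integrableOn_comp_preimage hemb).mpr (hF.mono_set hsub)
  · have h := hmp.setIntegral_preimage_emb hemb F (Set.Ioi 1)
    rw [hpre] at h
    rw [h]
    refine (setIntegral_eq_of_subset_of_forall_sdiff_eq_zero measurableSet_Ioi hsub ?_).symm
    intro x hx
    exact hzero x ⟨hx.1, not_lt.mp hx.2⟩

theorem SatisfiesExpParkingEq.one_sub_exp_mul {lam : ℝ} (hlam : 0 < lam) {M : ℝ → ℝ}
    (hM : SatisfiesExpParkingEq lam M) {x : ℝ} (hx : 0 < x) :
    (1 - Real.exp (-lam * x)) * (M (x + 1) - 1) =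
      ∫ t in (0 : ℝ)..x, lam * Real.exp (-lam * t) * (M t + M (x - t)) := by
  have hne : 1 - Real.exp (-lam * x) ≠ 0 := by
    have : Real.exp (-lam * x) < 1 := Real.exp_lt_one_iff.mpr (by nlinarith)
    linarith
  rw [hM.2 x hx, add_sub_cancel_right, ← intervalIntegral.integral_const_mul]
  congr 1 with t
  rw [← mul_assoc, mul_div_cancel₀ _ hne]

theorem SatisfiesExpParkingEq.laplace_integrand_eq {lam : ℝ} (hlam : 0 < lam) {M : ℝ → ℝ}
    (hmeas : Measurable M) (hbound : ∀ x : ℝ, 0 ≤ x → 0 ≤ M x ∧ M x ≤ x)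
    (hM : SatisfiesExpParkingEq lam M) (s : ℂ) {x : ℝ} (hx : 0 < x) :
    Complex.exp s * ((M (x + 1) : ℂ) * Complex.exp (-s * (x + 1 : ℝ)))
        - Complex.exp (s + lam) * ((M (x + 1) : ℂ) * Complex.exp (-(s + lam) * (x + 1 : ℝ)))
        - Complex.exp (-s * x) + Complex.exp (-(s + lam) * x) =
      lam * (∫ t in (0 : ℝ)..x,
        ((M t : ℂ) * Complex.exp (-(s + lam) * t)) * Complex.exp (-s * (x - t : ℝ)))
      + lam * (∫ t in (0 : ℝ)..x,
        Complex.exp (-(s + lam) * t) *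
          ((M (x - t) : ℂ) * Complex.exp (-s * (x - t : ℝ)))) := by
  have hMi := intervalIntegrable_of_le_id hmeas hbound hx.le
  have hMi' : IntervalIntegrable (fun t => M (x - t)) volume 0 x := by
    simpa using (hMi.comp_sub_left x).symm
  have hMc : IntervalIntegrable (fun t => (M t : ℂ)) volume 0 x :=
    ⟨hMi.1.ofReal, hMi.2.ofReal⟩
  have hMc' : IntervalIntegrable (fun t => (M (x - t) : ℂ)) volume 0 x :=
    ⟨hMi'.1.ofReal, hMi'.2.ofReal⟩
  have h1 : IntervalIntegrable (fun t : ℝ => ((M t : ℂ) * Complex.exp (-(s + lam) * t)) *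
      Complex.exp (-s * (x - t : ℝ))) volume 0 x :=
    (hMc.mul_continuousOn (by fun_prop)).mul_continuousOn (by fun_prop)
  have h2 : IntervalIntegrable (fun t : ℝ => Complex.exp (-(s + lam) * t) *
      ((M (x - t) : ℂ) * Complex.exp (-s * (x - t : ℝ)))) volume 0 x :=
    (hMc'.mul_continuousOn (by fun_prop)).continuousOn_mul (by fun_prop)
  rw [← mul_add, ← intervalIntegral.integral_add h1 h2, ← intervalIntegral.integral_const_mul]
  have hreal := congrArg (fun r : ℝ => Complex.exp (-s * x) * (r : ℂ))
    (hM.one_sub_exp_mul hlam hx)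
  simp only [← intervalIntegral.integral_ofReal, ← intervalIntegral.integral_const_mul] at hreal
  have hshift (z : ℂ) : Complex.exp z * Complex.exp (-z * (x + 1 : ℝ)) = Complex.exp (-z * x) := by
    rw [← Complex.exp_add]; congr 1; push_cast; ring
  have hsplit (t : ℝ) :
      Complex.exp (-(s + lam) * t) = Complex.exp (-s * t) * Complex.exp (-lam * t) := by
    rw [← Complex.exp_add]; congr 1; ring
  have hcomb (t : ℝ) :
      Complex.exp (-s * x) = Complex.exp (-s * t) * Complex.exp (-s * (x - t : ℝ)) := by
    rw [← Complex.exp_add]; congr 1; push_cast; ring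
  calc _ = Complex.exp (-s * x) *
        (((1 - Real.exp (-lam * x)) * (M (x + 1) - 1) : ℝ) : ℂ) := by
        rw [mul_left_comm, hshift, mul_left_comm, hshift, hsplit]
        push_cast
        ring
    _ = _ := hreal
    _ = _ := by
        congr 1 with t
        rw [hcomb t, hsplit]
        push_cast
        ring

/-- **Functional equation (12) of the paper** for the Laplace transform
`φ s = ∫₀^∞ M x e^{-s x} dx` of a solution of the exponential parking equation:
for `Re s > 0`, `e^s (s+λ) - λ ≠ 0` and
`s² φ(s) (e^s (s+λ) - λ) = s (λ + (s+λ)(s e^{s+λ} + λ) φ(s+λ))`. -/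
theorem expParking_laplace_functional_eq
    (lam : ℝ) (hlam : 0 < lam) (M : ℝ → ℝ)
    (hmeas : Measurable M)
    (hbound : ∀ x : ℝ, 0 ≤ x → 0 ≤ M x ∧ M x ≤ x)
    (hM : SatisfiesExpParkingEq lam M)
    (φ : ℂ → ℂ)
    (hφ : ∀ s : ℂ, 0 < s.re →
      φ s = ∫ x in Set.Ioi (0:ℝ), (M x : ℂ) * Complex.exp (-s * x)) :
    ∀ s : ℂ, 0 < s.re →
      Complex.exp s * (s + (lam : ℂ)) - (lam : ℂ) ≠ 0 ∧
      s ^ 2 * φ s * (Complex.exp s * (s + (lam : ℂ)) - (lam : ℂ))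
        = s * ((lam : ℂ) + (s + (lam : ℂ)) * (s * Complex.exp (s + (lam : ℂ)) + (lam : ℂ))
          * φ (s + (lam : ℂ))) := by
  intro s hs
  refine ⟨cexp_mul_add_sub_ne_zero hlam hs, ?_⟩
  have hsl : 0 < (s + (lam : ℂ)).re := by simpa using add_pos hs hlam
  have hF {z : ℂ} (hz : 0 < z.re) := integrableOn_mul_cexp_of_le_id hmeas hbound hz
  have hE {z : ℂ} (hz : 0 < z.re) :
      IntegrableOn (fun x : ℝ => Complex.exp (-z * x)) (Set.Ioi 0) :=
    integrableOn_exp_mul_complex_Ioi (by simpa using hz) 0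
  have hEint {z : ℂ} (hz : 0 < z.re) :
      ∫ x in Set.Ioi (0 : ℝ), Complex.exp (-z * x) = 1 / z := by
    rw [integral_exp_mul_complex_Ioi (by simpa using hz)]
    simp
  have hzero (z : ℂ) : ∀ x ∈ Set.Ioc (0 : ℝ) 1, (M x : ℂ) * Complex.exp (-z * x) = 0 := by
    intro x hx
    simp [hM.1 x hx.1.le hx.2]
  obtain ⟨hi1, he1⟩ := integrableOn_and_integral_comp_add_one (hF hs) (hzero s)
  obtain ⟨hi2, he2⟩ := integrableOn_and_integral_comp_add_one (hF hsl) (hzero (s + lam))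
  have hconv {f g : ℝ → ℂ} (hf : IntegrableOn f (Set.Ioi 0) volume)
      (hg : IntegrableOn g (Set.Ioi 0) volume) :
      IntegrableOn (fun x => ∫ t in (0 : ℝ)..x, f t * g (x - t)) (Set.Ioi 0) ∧
      ∫ x in Set.Ioi (0 : ℝ), ∫ t in (0 : ℝ)..x, f t * g (x - t) =
        (∫ x in Set.Ioi (0 : ℝ), f x) * ∫ x in Set.Ioi (0 : ℝ), g x :=
    ⟨(integrable_indicator_iff measurableSet_Ioi).mp
      (integrable_posConvolution hf hg (ContinuousLinearMap.mul ℝ ℂ)),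
      integral_posConvolution hf hg (ContinuousLinearMap.mul ℝ ℂ)⟩
  obtain ⟨hc1, hv1⟩ := hconv (hF hsl) (hE hs)
  obtain ⟨hc2, hv2⟩ := hconv (hE hsl) (hF hs)
  have hlaplace := setIntegral_congr_fun (μ := volume) measurableSet_Ioi
    fun x hx => hM.laplace_integrand_eq hlam hmeas hbound s (Set.mem_Ioi.mp hx)
  have hsub {f g : ℝ → ℂ} (hf : IntegrableOn f (Set.Ioi 0) volume)
      (hg : IntegrableOn g (Set.Ioi 0) volume) :
      Integrable (fun x => f x - g x) (volume.restrict (Set.Ioi 0)) :=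
    hf.sub hg
  have hd := hsub (hi1.const_mul (Complex.exp s)) (hi2.const_mul (Complex.exp (s + lam)))
  rw [integral_add (hsub hd (hE hs)) (hE hsl), integral_sub hd (hE hs),
    integral_sub (hi1.const_mul _) (hi2.const_mul _),
    integral_add (hc1.const_mul _) (hc2.const_mul _)] at hlaplace
  simp only [integral_const_mul] at hlaplace
  rw [he1, he2, hv1, hv2, hEint hs, hEint hsl, ← hφ s hs, ← hφ _ hsl] at hlaplace
  have hs0 : s ≠ 0 := fun h => by simp [h] at hs
  have hsl0 : s + (lam : ℂ) ≠ 0 := fun h => by simp [h] at hsl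
  field_simp at hlaplace
  linear_combination s * hlaplace
end

section
/- Let λ > 0 and let M : ℝ → ℝ be measurable and nondecreasing with 0 ≤ M(x) ≤ x for all x ≥ 0, satisfying the exponential parking equation with rate λ. Then the limit C_λ := lim_{x→∞} M(x)/x exists and C_λ = (λ/(λ+1)) · (1 + λ φ(λ)), where φ(λ) = ∫₀^∞ M(x) e^{−λx} dx. -/
open MeasureTheory Filter

lemma mul_exp_neg_mul_le {lam : ℝ} (hlam : 0 < lam) (t : ℝ) :
    t * Real.exp (-lam * t) ≤ 2 / lam * Real.exp (-(lam / 2) * t) := by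
  have h1 : lam / 2 * t ≤ Real.exp (lam / 2 * t) := by
    linarith [Real.add_one_le_exp (lam / 2 * t)]
  have h2 : t ≤ 2 / lam * Real.exp (lam / 2 * t) := by
    rw [div_mul_eq_mul_div, le_div_iff₀ hlam]
    linarith
  calc t * Real.exp (-lam * t)
      ≤ 2 / lam * Real.exp (lam / 2 * t) * Real.exp (-lam * t) := by gcongr
    _ = 2 / lam * Real.exp (-(lam / 2) * t) := by
      rw [mul_assoc, ← Real.exp_add]
      ring_nf

lemma MonotoneOn.intervalIntegrable_of_Ici {M : ℝ → ℝ} (hmono : MonotoneOn M (Set.Ici 0))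
    {a b : ℝ} (ha : 0 ≤ a) (hb : 0 ≤ b) : IntervalIntegrable M volume a b :=
  (hmono.mono fun _ hx => le_trans (le_min ha hb) hx.1).intervalIntegrable

/-- The convolution `∫₀ˣ lam * e^{-lam (x - u)} * M u du`. -/
noncomputable def expConv (lam : ℝ) (M : ℝ → ℝ) (x : ℝ) : ℝ :=
  Real.exp (-lam * x) * ∫ u in (0:ℝ)..x, lam * Real.exp (lam * u) * M u

lemma intervalIntegrable_exp_mul {M : ℝ → ℝ} (hmono : MonotoneOn M (Set.Ici 0)) (c k : ℝ)
    {a b : ℝ} (ha : 0 ≤ a) (hb : 0 ≤ b) :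
    IntervalIntegrable (fun u => c * Real.exp (k * u) * M u) volume a b :=
  (hmono.intervalIntegrable_of_Ici ha hb).continuousOn_mul (by fun_prop)

lemma continuousOn_expConv {M : ℝ → ℝ} (hmono : MonotoneOn M (Set.Ici 0)) (lam : ℝ)
    {x : ℝ} (hx : 0 ≤ x) : ContinuousOn (expConv lam M) (Set.Icc 0 x) := by
  have h := intervalIntegral.continuousOn_primitive_interval'
    (intervalIntegrable_exp_mul hmono lam lam le_rfl hx) Set.left_mem_uIcc
  rw [Set.uIcc_of_le hx] at h
  exact ContinuousOn.mul (by fun_prop) h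

lemma intervalIntegrable_expConv {M : ℝ → ℝ} (hmono : MonotoneOn M (Set.Ici 0)) (lam : ℝ)
    {x : ℝ} (hx : 0 ≤ x) : IntervalIntegrable (expConv lam M) volume 0 x :=
  (continuousOn_expConv hmono lam hx).intervalIntegrable_of_Icc hx

/-- Integrated form of the differential equation satisfied by `expConv lam M`. -/
lemma expConv_add_integral {M : ℝ → ℝ} (hmeas : Measurable M) (hmono : MonotoneOn M (Set.Ici 0))
    (lam : ℝ) {x : ℝ} (hx : 0 ≤ x) :
    expConv lam M x + lam * ∫ u in (0:ℝ)..x, expConv lam M u = lam * ∫ u in (0:ℝ)..x, M u := by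
  have hiM := hmono.intervalIntegrable_of_Ici le_rfl hx
  have hiG := intervalIntegrable_expConv hmono lam hx
  have key := integral_eq_of_hasDerivAt_off_countable_of_le (expConv lam M)
    (fun u => lam * M u - lam * expConv lam M u) hx hmono.countable_not_continuousWithinAt
    (continuousOn_expConv hmono lam hx) ?_ ((hiM.const_mul lam).sub (hiG.const_mul lam))
  · rw [intervalIntegral.integral_sub (hiM.const_mul lam) (hiG.const_mul lam),
      intervalIntegral.integral_const_mul, intervalIntegral.integral_const_mul] at key
    have h0 : expConv lam M 0 = 0 := by simp [expConv]
    linarith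
  · rintro u ⟨⟨hu0, -⟩, hu⟩
    have hc : ContinuousAt M u := by
      by_contra hcon
      refine hu ⟨hu0.le, fun h => hcon (h.continuousAt (Ici_mem_nhds hu0))⟩
    have hF := intervalIntegral.integral_hasDerivAt_right
      (intervalIntegrable_exp_mul hmono lam lam le_rfl hu0.le)
      ((by fun_prop : Measurable fun u => lam * Real.exp (lam * u) * M u)
        |>.stronglyMeasurable.stronglyMeasurableAtFilter)
      (by fun_prop : ContinuousAt (fun u => lam * Real.exp (lam * u) * M u) u)
    have hE : HasDerivAt (fun u => Real.exp (-lam * u)) (Real.exp (-lam * u) * (-lam * 1)) u :=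
      ((hasDerivAt_id u).const_mul (-lam)).exp
    refine (hE.mul hF).congr_deriv ?_
    have hee : Real.exp (-lam * u) * Real.exp (lam * u) = 1 := by
      rw [← Real.exp_add]
      simp
    unfold expConv
    linear_combination lam * M u * hee

lemma integral_exp_mul_reflect (lam : ℝ) (M : ℝ → ℝ) (x : ℝ) :
    ∫ t in (0:ℝ)..x, lam * Real.exp (-lam * t) * M (x - t) = expConv lam M x := by
  have h := intervalIntegral.integral_comp_sub_left (a := 0) (b := x)
    (fun u => Real.exp (-lam * x) * (lam * Real.exp (lam * u) * M u)) x
  rw [sub_self, sub_zero] at h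
  rw [expConv, ← intervalIntegral.integral_const_mul, ← h]
  congr 1
  ext t
  have : Real.exp (-lam * t) = Real.exp (-lam * x) * Real.exp (lam * (x - t)) := by
    rw [← Real.exp_add]
    ring_nf
  rw [this]
  ring

lemma SatisfiesExpParkingEq.expConv_eq {lam : ℝ} (hlam : 0 < lam) {M : ℝ → ℝ}
    (hmono : MonotoneOn M (Set.Ici 0)) (hM : SatisfiesExpParkingEq lam M) {x : ℝ} (hx : 0 < x) :
    expConv lam M x = (1 - Real.exp (-lam * x)) * (M (x + 1) - 1)
      - lam * ∫ t in (0:ℝ)..x, M t * Real.exp (-lam * t) := by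
  have hne : 1 - Real.exp (-lam * x) ≠ 0 := by
    have : Real.exp (-lam * x) < 1 := Real.exp_lt_one_iff.mpr (by nlinarith)
    linarith
  have hi1 := intervalIntegrable_exp_mul hmono lam (-lam) le_rfl hx.le
  have hi2 : IntervalIntegrable (fun t => lam * Real.exp (-lam * t) * M (x - t)) volume 0 x := by
    refine IntervalIntegrable.continuousOn_mul (f := fun t => M (x - t)) ?_ (by fun_prop)
    have := (hmono.intervalIntegrable_of_Ici hx.le le_rfl).comp_sub_left x
    simpa using this
  have hsplit : (∫ t in (0:ℝ)..x,
      (lam * Real.exp (-lam * t) / (1 - Real.exp (-lam * x))) * (M t + M (x - t)))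
      = (1 - Real.exp (-lam * x))⁻¹ * ((∫ t in (0:ℝ)..x, lam * Real.exp (-lam * t) * M t)
        + expConv lam M x) := by
    rw [← integral_exp_mul_reflect, ← intervalIntegral.integral_add hi1 hi2,
      ← intervalIntegral.integral_const_mul]
    congr 1
    ext t
    ring
  have hA : (∫ t in (0:ℝ)..x, lam * Real.exp (-lam * t) * M t)
      = lam * ∫ t in (0:ℝ)..x, M t * Real.exp (-lam * t) := by
    rw [← intervalIntegral.integral_const_mul]
    congr 1
    ext t
    ring
  rw [hM.2 x hx, hsplit, hA, add_sub_cancel_right, mul_inv_cancel_left₀ hne]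
  ring

lemma integrableOn_mul_exp_neg {lam : ℝ} {M : ℝ → ℝ}
    (hlam : 0 < lam) (hmeas : Measurable M)
    (hbound : ∀ x : ℝ, 0 ≤ x → 0 ≤ M x ∧ M x ≤ x) {x : ℝ} (hx : 0 ≤ x) :
    IntegrableOn (fun t => M t * Real.exp (-lam * t)) (Set.Ioi x) := by
  refine ((exp_neg_integrableOn_Ioi x (half_pos hlam)).const_mul (2 / lam)).mono'
    (by fun_prop : Measurable fun t => M t * Real.exp (-lam * t)).aestronglyMeasurable ?_
  refine (ae_restrict_iff' measurableSet_Ioi).mpr (.of_forall fun t ht => ?_)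
  obtain ⟨h0, h1⟩ := hbound t (hx.trans (le_of_lt ht))
  rw [Real.norm_of_nonneg (by positivity)]
  exact le_trans (by gcongr) (mul_exp_neg_mul_le hlam t)

lemma setIntegral_Ioi_mul_exp_neg_nonneg {lam : ℝ} {M : ℝ → ℝ}
    (hbound : ∀ x : ℝ, 0 ≤ x → 0 ≤ M x ∧ M x ≤ x) {x : ℝ} (hx : 0 ≤ x) :
    0 ≤ ∫ t in Set.Ioi x, M t * Real.exp (-lam * t) :=
  setIntegral_nonneg measurableSet_Ioi fun t ht =>
    mul_nonneg (hbound t (hx.trans (le_of_lt ht))).1 (Real.exp_pos _).le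

lemma setIntegral_Ioi_mul_exp_neg_le {lam : ℝ} {M : ℝ → ℝ}
    (hlam : 0 < lam) (hmeas : Measurable M)
    (hbound : ∀ x : ℝ, 0 ≤ x → 0 ≤ M x ∧ M x ≤ x) {x : ℝ} (hx : 0 ≤ x) :
    ∫ t in Set.Ioi x, M t * Real.exp (-lam * t)
      ≤ (2 / lam) ^ 2 * Real.exp (-(lam / 2) * x) := by
  calc ∫ t in Set.Ioi x, M t * Real.exp (-lam * t)
      ≤ ∫ t in Set.Ioi x, 2 / lam * Real.exp (-(lam / 2) * t) := by
        refine setIntegral_mono_on (integrableOn_mul_exp_neg hlam hmeas hbound hx)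
          ((exp_neg_integrableOn_Ioi x (half_pos hlam)).const_mul (2 / lam))
          measurableSet_Ioi fun t ht => ?_
        have h1 := (hbound t (hx.trans (le_of_lt ht))).2
        exact le_trans (by gcongr) (mul_exp_neg_mul_le hlam t)
    _ = (2 / lam) ^ 2 * Real.exp (-(lam / 2) * x) := by
        rw [integral_const_mul, integral_exp_mul_Ioi (by linarith)]
        field_simp

lemma SatisfiesExpParkingEq.abs_expConv_sub_le {lam : ℝ} {M : ℝ → ℝ}
    (hlam : 0 < lam) (hmeas : Measurable M)
    (hmono : MonotoneOn M (Set.Ici 0)) (hbound : ∀ x : ℝ, 0 ≤ x → 0 ≤ M x ∧ M x ≤ x)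
    (hM : SatisfiesExpParkingEq lam M) {x : ℝ} (hx : 0 < x) :
    |expConv lam M x -
      (M (x + 1) - (1 + lam * ∫ t in Set.Ioi (0:ℝ), M t * Real.exp (-lam * t)))|
      ≤ (2 / lam + 1 + lam * (2 / lam) ^ 2) * Real.exp (-(lam / 2) * x) := by
  have hsum := intervalIntegral.integral_interval_add_Ioi
    (integrableOn_mul_exp_neg hlam hmeas hbound le_rfl)
    (integrableOn_mul_exp_neg hlam hmeas hbound hx.le)
  have hT0 := setIntegral_Ioi_mul_exp_neg_nonneg (lam := lam) hbound hx.le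
  have hT1 := setIntegral_Ioi_mul_exp_neg_le hlam hmeas hbound hx.le
  rw [hM.expConv_eq hlam hmono hx, ← hsum]
  set T := ∫ t in Set.Ioi x, M t * Real.exp (-lam * t)
  obtain ⟨h0, h1⟩ := hbound (x + 1) (by linarith)
  have hE : |Real.exp (-lam * x) * (M (x + 1) - 1)|
      ≤ (2 / lam + 1) * Real.exp (-(lam / 2) * x) := by
    have hx1 : |M (x + 1) - 1| ≤ x + 1 := abs_le.mpr ⟨by linarith, by linarith⟩
    have hexp : Real.exp (-lam * x) ≤ Real.exp (-(lam / 2) * x) :=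
      Real.exp_le_exp.mpr (by nlinarith)
    rw [abs_mul, abs_of_pos (Real.exp_pos _)]
    calc Real.exp (-lam * x) * |M (x + 1) - 1| ≤ Real.exp (-lam * x) * (x + 1) := by gcongr
      _ ≤ _ := by linarith [mul_exp_neg_mul_le hlam x]
  have hT : lam * T ≤ lam * ((2 / lam) ^ 2 * Real.exp (-(lam / 2) * x)) := by gcongr
  have hT' : 0 ≤ lam * T := by positivity
  obtain ⟨hE1, hE2⟩ := abs_le.mp hE
  rw [abs_le]
  constructor <;> linarith

/-- The equation `M (x+1) + lam * ∫ₓˣ⁺¹ M = lam * c * x + O(1)`, where `c = 1 + lam * φ(lam)`. -/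
lemma SatisfiesExpParkingEq.exists_abs_add_integral_sub_le {lam : ℝ} {M : ℝ → ℝ}
    (hlam : 0 < lam) (hmeas : Measurable M)
    (hmono : MonotoneOn M (Set.Ici 0)) (hbound : ∀ x : ℝ, 0 ≤ x → 0 ≤ M x ∧ M x ≤ x)
    (hM : SatisfiesExpParkingEq lam M) :
    ∃ B, ∀ x, 0 < x → |M (x + 1) + lam * (∫ u in x..(x + 1), M u)
      - lam * (1 + lam * ∫ t in Set.Ioi (0:ℝ), M t * Real.exp (-lam * t)) * x| ≤ B := by
  have habs := fun x (hx : 0 < x) => hM.abs_expConv_sub_le hlam hmeas hmono hbound hx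
  set c := 1 + lam * ∫ t in Set.Ioi (0:ℝ), M t * Real.exp (-lam * t) with hc
  set K := 2 / lam + 1 + lam * (2 / lam) ^ 2 with hK
  have hK0 : 0 ≤ K := by positivity
  refine ⟨|c| + K + lam * (K * (2 / lam)), fun x hx => ?_⟩
  have hiG := intervalIntegrable_expConv hmono lam hx.le
  have hiM : ∀ {a b : ℝ}, 0 ≤ a → 0 ≤ b → IntervalIntegrable M volume a b :=
    hmono.intervalIntegrable_of_Ici
  have hiS : IntervalIntegrable (fun u => M (u + 1)) volume 0 x := by
    have := (hiM (a := 1) (b := x + 1) (by linarith) (by linarith)).comp_add_right 1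
    simpa using this
  have hode := expConv_add_integral hmeas hmono lam hx.le
  have hint : ‖∫ u in (0:ℝ)..x, (expConv lam M u - (M (u + 1) - c))‖ ≤ K * (2 / lam) := by
    refine (intervalIntegral.norm_integral_le_of_norm_le hx.le
      (.of_forall fun u hu => habs u hu.1) (Continuous.intervalIntegrable (by fun_prop) _ _)).trans
      ?_
    rw [intervalIntegral.integral_const_mul]
    gcongr
    rw [intervalIntegral.integral_of_le hx.le]
    refine (setIntegral_mono_set (exp_neg_integrableOn_Ioi 0 (half_pos hlam))
      (.of_forall fun u => (Real.exp_pos _).le) Set.Ioc_subset_Ioi_self.eventuallyLE).trans ?_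
    rw [integral_exp_mul_Ioi (by linarith)]
    simp
  rw [intervalIntegral.integral_sub hiG (hiS.sub intervalIntegrable_const),
    intervalIntegral.integral_sub hiS intervalIntegrable_const, intervalIntegral.integral_const,
    intervalIntegral.integral_comp_add_right, zero_add, sub_zero, smul_eq_mul,
    Real.norm_eq_abs] at hint
  have hzero : ∫ u in (0:ℝ)..1, M u = 0 := by
    rw [intervalIntegral.integral_congr (g := fun _ => (0:ℝ)), intervalIntegral.integral_zero]
    intro u hu
    rw [Set.uIcc_of_le zero_le_one] at hu
    exact hM.1 u hu.1 hu.2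
  have hadd1 := intervalIntegral.integral_add_adjacent_intervals
    (hiM le_rfl zero_le_one) (hiM zero_le_one (by linarith : 0 ≤ x + 1))
  have hadd2 := intervalIntegral.integral_add_adjacent_intervals
    (hiM le_rfl hx.le) (hiM hx.le (by linarith : 0 ≤ x + 1))
  have hδ := habs x hx
  have hexp : K * Real.exp (-(lam / 2) * x) ≤ K :=
    mul_le_of_le_one_right hK0 (Real.exp_le_one_iff.mpr (by nlinarith))
  set I := (∫ u in (0:ℝ)..x, expConv lam M u) - ((∫ u in (1:ℝ)..(x + 1), M u) - x * c) with hI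
  have hI' : |lam * I| ≤ lam * (K * (2 / lam)) := by
    rw [abs_mul, abs_of_pos hlam]
    gcongr
  have hJ : ∫ u in x..(x + 1), M u = (∫ u in (1:ℝ)..(x + 1), M u) - ∫ u in (0:ℝ)..x, M u := by
    linarith
  have hid : M (x + 1) + lam * (∫ u in x..(x + 1), M u) - lam * c * x
      = c - (expConv lam M x - (M (x + 1) - c)) - lam * I := by
    rw [hJ, hI]
    linear_combination hode
  rw [hid]
  obtain ⟨a1, a2⟩ := abs_le.mp hI'
  obtain ⟨b1, b2⟩ := abs_le.mp (hδ.trans hexp)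
  rw [abs_le]
  constructor <;> linarith [le_abs_self c, neg_abs_le c]

lemma tendsto_div_atTop_of_abs_sub_mul_le {f : ℝ → ℝ} {s B : ℝ}
    (h : ∀ᶠ x in atTop, |f x - s * x| ≤ B) : Tendsto (fun x => f x / x) atTop (nhds s) := by
  rw [tendsto_iff_norm_sub_tendsto_zero]
  refine squeeze_zero' (.of_forall fun _ => norm_nonneg _) ?_
    (tendsto_const_nhds.div_atTop tendsto_id : Tendsto (fun x : ℝ => B / x) atTop (nhds 0))
  filter_upwards [h, eventually_gt_atTop 0] with x hx hx0
  rw [show f x / x - s = (f x - s * x) / x by field_simp, norm_div, Real.norm_eq_abs,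
    Real.norm_of_nonneg hx0.le]
  gcongr

/-- **Formula (23) of the paper.** For a solution of the exponential parking
equation, the asymptotic slope `C_λ = lim_{x→∞} M x / x` exists and equals
`(λ/(λ+1)) (1 + λ φ(λ))`, where `φ(λ) = ∫₀^∞ M x e^{-λ x} dx`. -/
theorem expParking_asymptotic_slope
    (lam : ℝ) (hlam : 0 < lam) (M : ℝ → ℝ)
    (hmeas : Measurable M)
    (hmono : MonotoneOn M (Set.Ici 0))
    (hbound : ∀ x : ℝ, 0 ≤ x → 0 ≤ M x ∧ M x ≤ x)
    (hM : SatisfiesExpParkingEq lam M) :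
    Tendsto (fun x : ℝ => M x / x) atTop
      (nhds ((lam / (lam + 1)) *
        (1 + lam * ∫ x in Set.Ioi (0:ℝ), M x * Real.exp (-lam * x)))) := by
  obtain ⟨B, hB⟩ := hM.exists_abs_add_integral_sub_le hlam hmeas hmono hbound
  set c := 1 + lam * ∫ t in Set.Ioi (0:ℝ), M t * Real.exp (-lam * t)
  have hmean : ∀ x, 0 < x → M x ≤ (∫ u in x..(x + 1), M u) ∧
      (∫ u in x..(x + 1), M u) ≤ M (x + 1) := by
    intro x hx
    have hi : IntervalIntegrable M volume x (x + 1) :=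
      hmono.intervalIntegrable_of_Ici hx.le (by linarith)
    constructor
    · have := intervalIntegral.integral_mono_on (by linarith : x ≤ x + 1)
        (intervalIntegrable_const (c := M x)) hi
        fun u hu => hmono hx.le (hx.le.trans hu.1) hu.1
      simpa using this
    · have := intervalIntegral.integral_mono_on (by linarith : x ≤ x + 1) hi
        (intervalIntegrable_const (c := M (x + 1)))
        fun u hu => hmono (hx.le.trans hu.1) (by simp; linarith) hu.2
      simpa using this
  have hl : 0 < lam + 1 := by linarith
  refine tendsto_div_atTop_of_abs_sub_mul_le (B := (B + |lam * c|) / (lam + 1)) ?_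
  filter_upwards [eventually_gt_atTop 1] with x hx
  rw [show M x - lam / (lam + 1) * c * x = ((lam + 1) * M x - lam * c * x) / (lam + 1) by
    field_simp, abs_div, abs_of_pos hl]
  gcongr
  have hupper := (abs_le.mp (hB x (by linarith))).2
  have hlower := (abs_le.mp (hB (x - 1) (by linarith))).1
  have hm1 := (hmean x (by linarith)).1
  have hm2 := (hmean (x - 1) (by linarith)).2
  rw [sub_add_cancel] at hlower hm2
  have hstep : M x ≤ M (x + 1) := hmono (by simp; linarith) (by simp; linarith) (by linarith)
  have h1 := mul_le_mul_of_nonneg_left hm1 hlam.le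
  have h2 := mul_le_mul_of_nonneg_left hm2 hlam.le
  rw [abs_le]
  constructor <;> linarith [le_abs_self (lam * c), neg_abs_le (lam * c)]
end

section
/- Let λ > 0 and let M : ℝ → ℝ be locally integrable and satisfy the exponential parking equation with rate λ. Then for all x > 0, ⌈(x−1)/2⌉ ≤ M(x) ≤ ⌊x⌋. -/
open MeasureTheory Filter

/-- The exponential parking weight has total mass one. -/
theorem integral_expParking_weight {lam x : ℝ} (hlam : 0 < lam) (hx : 0 < x) :
    ∫ t in (0:ℝ)..x, lam * Real.exp (-lam * t) / (1 - Real.exp (-lam * x)) = 1 := by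
  have hexp : Real.exp (-lam * x) < 1 := Real.exp_lt_one_iff.mpr (by nlinarith)
  have hderiv : ∀ t ∈ Set.uIcc 0 x,
      HasDerivAt (fun t => -Real.exp (-lam * t)) (lam * Real.exp (-lam * t)) t := by
    intro t _
    exact (((hasDerivAt_id t).const_mul (-lam)).exp).neg.congr_deriv (by simp [mul_comm])
  rw [intervalIntegral.integral_div, intervalIntegral.integral_eq_sub_of_hasDerivAt hderiv
    (Continuous.intervalIntegrable (by fun_prop) _ _)]
  simp only [mul_zero, Real.exp_zero]
  rw [div_eq_one_iff_eq (by linarith)]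
  ring

/-- Bounds on a function carry over to its average against the exponential parking weight. -/
theorem expParking_average_mem_Icc {lam x a b : ℝ} {f : ℝ → ℝ} (hlam : 0 < lam) (hx : 0 < x)
    (hf : IntervalIntegrable f volume 0 x) (hab : ∀ t ∈ Set.Icc 0 x, f t ∈ Set.Icc a b) :
    ∫ t in (0:ℝ)..x, lam * Real.exp (-lam * t) / (1 - Real.exp (-lam * x)) * f t
      ∈ Set.Icc a b := by
  have hexp : Real.exp (-lam * x) < 1 := Real.exp_lt_one_iff.mpr (by nlinarith)
  have hw : Continuous fun t => lam * Real.exp (-lam * t) / (1 - Real.exp (-lam * x)) := by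
    fun_prop
  have hpos : ∀ t, 0 ≤ lam * Real.exp (-lam * t) / (1 - Real.exp (-lam * x)) := fun t =>
    div_nonneg (by positivity) (by linarith)
  have hconst : ∀ c : ℝ,
      ∫ t in (0:ℝ)..x, lam * Real.exp (-lam * t) / (1 - Real.exp (-lam * x)) * c = c := by
    intro c
    rw [intervalIntegral.integral_mul_const, integral_expParking_weight hlam hx, one_mul]
  have hint := hf.continuousOn_mul hw.continuousOn
  have hint_const : ∀ c : ℝ, IntervalIntegrable
      (fun t => lam * Real.exp (-lam * t) / (1 - Real.exp (-lam * x)) * c) volume 0 x :=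
    fun c => (hw.mul continuous_const).intervalIntegrable _ _
  constructor
  · rw [← hconst a]
    exact intervalIntegral.integral_mono_on hx.le (hint_const a) (by simpa using hint)
      fun t ht => mul_le_mul_of_nonneg_left (hab t ht).1 (hpos t)
  · rw [← hconst b]
    exact intervalIntegral.integral_mono_on hx.le (by simpa using hint) (hint_const b)
      fun t ht => mul_le_mul_of_nonneg_left (hab t ht).2 (hpos t)

/-- **Estimate (4) of the paper.** A locally integrable solution of the
exponential parking equation satisfies `⌈(x-1)/2⌉ ≤ M x ≤ ⌊x⌋` for all `x > 0`. -/
theorem expParking_floor_ceil_bounds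
    (lam : ℝ) (hlam : 0 < lam) (M : ℝ → ℝ)
    (hloc : LocallyIntegrable M)
    (hM : SatisfiesExpParkingEq lam M) :
    ∀ x : ℝ, 0 < x → (⌈(x - 1) / 2⌉ : ℝ) ≤ M x ∧ M x ≤ (⌊x⌋ : ℝ) := by
  suffices h : ∀ n : ℕ, ∀ x : ℝ, 0 ≤ x → x ≤ n + 1 →
      (⌈(x - 1) / 2⌉ : ℝ) ≤ M x ∧ M x ≤ (⌊x⌋ : ℝ) by
    intro x hx
    obtain ⟨n, hn⟩ := exists_nat_ge x
    exact h n x hx.le (by linarith)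
  intro n
  induction n with
  | zero =>
    intro x hx0 hx1
    have hx1' : x ≤ 1 := by simpa using hx1
    rw [hM.1 x hx0 hx1']
    constructor
    · exact_mod_cast Int.ceil_le.mpr (by push_cast; linarith)
    · exact_mod_cast Int.floor_nonneg.mpr hx0
  | succ n ih =>
    intro x hx0 hxn
    push_cast at hxn
    rcases le_or_gt x (n + 1) with hle | hgt
    · exact ih x hx0 hle
    obtain ⟨y, rfl⟩ : ∃ y, x = y + 1 := ⟨x - 1, by ring⟩
    have hy : 0 < y := by
      have : (0 : ℝ) ≤ n := n.cast_nonneg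
      linarith
    have hMint : IntervalIntegrable M volume 0 y :=
      (hloc.integrableOn_isCompact isCompact_uIcc).intervalIntegrable
    have hMint' : IntervalIntegrable (fun t => M (y - t)) volume 0 y := by
      simpa using (hMint.comp_sub_left y).symm
    have hmem : ∀ t ∈ Set.Icc 0 y,
        M t + M (y - t) ∈ Set.Icc (⌈(y + 1 - 1) / 2⌉ - 1 : ℝ) (⌊y + 1⌋ - 1 : ℝ) := by
      intro t ht
      have h₁ := ih t ht.1 (by linarith [ht.2])
      have h₂ := ih (y - t) (by linarith [ht.2]) (by linarith [ht.1])
      have hceil : ⌈(y + 1 - 1) / 2⌉ - 1 ≤ ⌈(t - 1) / 2⌉ + ⌈(y - t - 1) / 2⌉ := by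
        rw [← Int.ceil_sub_one]
        refine le_trans (le_of_eq ?_) (Int.ceil_add_le _ _)
        congr 1
        ring
      have hfloor : ⌊t⌋ + ⌊y - t⌋ ≤ ⌊y + 1⌋ - 1 := by
        rw [Int.floor_add_one, add_sub_cancel_right]
        simpa using Int.le_floor_add t (y - t)
      have hceil' : (⌈(y + 1 - 1) / 2⌉ - 1 : ℝ) ≤ ⌈(t - 1) / 2⌉ + ⌈(y - t - 1) / 2⌉ := by
        exact_mod_cast hceil
      have hfloor' : (⌊t⌋ + ⌊y - t⌋ : ℝ) ≤ ⌊y + 1⌋ - 1 := by exact_mod_cast hfloor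
      exact ⟨by linarith [h₁.1, h₂.1], by linarith [h₁.2, h₂.2]⟩
    have havg := expParking_average_mem_Icc hlam hy (hMint.add hMint') hmem
    rw [hM.2 y hy]
    exact ⟨by linarith [havg.1], by linarith [havg.2]⟩
end
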